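/- arXiv:2306.11178 — 2 statements merged into one kernel-verified Lean document; each statement's English description precedes it below -/
import Mathlib

section
/- Let R > 0 and suppose u : closure(B_R) → ℝ is continuous on closure(B_R), twice continuously differentiable on B_R, positive on B_R, vanishes on ∂B_R, and satisfies Δu + 4π u = 0 on B_R. Then necessarily R = √π/2, and there exists a constant C > 0 such that u(x) = C·sin(2√π |x|)/|x| for all x ∈ B_R \ {0} (with u(0) = 2√π C). -/
open MeasureTheory Real

/-- The Laplacian on `ℝ³`: sum of the pure second directional derivatives along the
standard orthonormal basis. -/
noncomputable def lap (u : EuclideanSpace ℝ (Fin 3) → ℝ) (x : EuclideanSpace ℝ (Fin 3)) : ℝ :=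
  ∑ i : Fin 3, iteratedFDeriv ℝ 2 u x ![EuclideanSpace.single i 1, EuclideanSpace.single i 1]

open Filter Topology

/-- The second derivative of a `C²` function along a line. -/
theorem deriv_deriv_comp_line {E : Type*} [NormedAddCommGroup E] [NormedSpace ℝ E] {u : E → ℝ}
    {x : E} (hu : ContDiffAt ℝ 2 u x) (e : E) :
    deriv (deriv fun t : ℝ => u (x + t • e)) 0 = iteratedFDeriv ℝ 2 u x ![e, e] := by
  have hline : ∀ t : ℝ, HasDerivAt (fun t : ℝ => x + t • e) e t := fun t => by
    simpa using ((hasDerivAt_id t).smul_const e).const_add x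
  have hx : x + (0 : ℝ) • e = x := by simp
  have hcont : Tendsto (fun t : ℝ => x + t • e) (𝓝 0) (𝓝 x) := by
    simpa using (hline 0).continuousAt.tendsto
  have hfirst : deriv (fun t : ℝ => u (x + t • e)) =ᶠ[𝓝 0] fun t => fderiv ℝ u (x + t • e) e := by
    filter_upwards [hcont.eventually (hu.eventually (by simp))] with t ht
    exact ((ht.differentiableAt (by simp)).hasFDerivAt.comp_hasDerivAt t (hline t)).deriv
  rw [hfirst.deriv_eq, iteratedFDeriv_two_apply]
  have hd : HasFDerivAt (fderiv ℝ u) (fderiv ℝ (fderiv ℝ u) x) (x + (0 : ℝ) • e) := by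
    rw [hx]
    exact ((hu.fderiv_right (m := 1) (by norm_num)).differentiableAt (by simp)).hasFDerivAt
  exact ((ContinuousLinearMap.apply ℝ ℝ e).hasFDerivAt.comp_hasDerivAt (0 : ℝ)
    (hd.comp_hasDerivAt (0 : ℝ) (hline 0))).deriv

/-- The second-order necessary condition for a local minimum on the line. -/
theorem IsLocalMin.deriv_deriv_nonneg {f : ℝ → ℝ} {a : ℝ} (h : IsLocalMin f a)
    (hc : ContinuousAt f a) : 0 ≤ deriv (deriv f) a := by
  by_contra! hneg
  have hmax := isLocalMax_of_deriv_deriv_neg hneg h.deriv_eq_zero hc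
  have hconst : f =ᶠ[𝓝 a] fun _ => f a := by
    filter_upwards [h, hmax] with y h₁ h₂ using le_antisymm h₂ h₁
  have : deriv (deriv f) a = 0 := by
    rw [hconst.deriv.deriv_eq]
    simp
  exact hneg.ne this

theorem IsLocalMin.lap_nonneg {u : EuclideanSpace ℝ (Fin 3) → ℝ} {x : EuclideanSpace ℝ (Fin 3)}
    (h : IsLocalMin u x) (hu : ContDiffAt ℝ 2 u x) : 0 ≤ lap u x := by
  refine Finset.sum_nonneg fun i _ => ?_
  rw [← deriv_deriv_comp_line hu]
  have hcont : ContinuousAt (fun t : ℝ => x + t • EuclideanSpace.single i (1 : ℝ)) 0 := by fun_prop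
  refine IsLocalMin.deriv_deriv_nonneg ?_ ?_
  · have : Tendsto (fun t : ℝ => x + t • EuclideanSpace.single i (1 : ℝ)) (𝓝 0) (𝓝 x) := by
      simpa using hcont.tendsto
    filter_upwards [this.eventually h] with t ht
    simpa using ht
  · exact ContinuousAt.comp (g := u) (by simpa using hu.continuousAt) hcont

theorem lap_sub {u v : EuclideanSpace ℝ (Fin 3) → ℝ} {x : EuclideanSpace ℝ (Fin 3)}
    (hu : ContDiffAt ℝ 2 u x) (hv : ContDiffAt ℝ 2 v x) :
    lap (fun y => u y - v y) x = lap u x - lap v x := by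
  simp only [lap, ← Finset.sum_sub_distrib]
  refine Finset.sum_congr rfl fun i _ => ?_
  have : (fun y => u y - v y) = u - v := rfl
  rw [this, iteratedFDeriv_sub_apply hu hv]
  rfl

theorem lap_const_mul {u : EuclideanSpace ℝ (Fin 3) → ℝ} {x : EuclideanSpace ℝ (Fin 3)}
    (c : ℝ) (hu : ContDiffAt ℝ 2 u x) : lap (fun y => c * u y) x = c * lap u x := by
  simp only [lap, Finset.mul_sum]
  refine Finset.sum_congr rfl fun i _ => ?_
  have : (fun y => c * u y) = c • u := rfl
  rw [this, iteratedFDeriv_const_smul_apply hu]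
  rfl

/-- The Laplacian of a function of the squared distance to a point. -/
theorem lap_comp_norm_sq {G : ℝ → ℝ} (x y : EuclideanSpace ℝ (Fin 3))
    (hG : ContDiffAt ℝ 2 G (‖x - y‖ ^ 2)) :
    lap (fun z => G (‖z - y‖ ^ 2)) x =
      4 * ‖x - y‖ ^ 2 * deriv (deriv G) (‖x - y‖ ^ 2) + 6 * deriv G (‖x - y‖ ^ 2) := by
  have hC : ContDiffAt ℝ 2 (fun z => G (‖z - y‖ ^ 2)) x :=
    ContDiffAt.comp x hG ((contDiffAt_id.sub contDiffAt_const).norm_sq ℝ)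
  have hcoord : ∀ i : Fin 3,
      iteratedFDeriv ℝ 2 (fun z => G (‖z - y‖ ^ 2)) x
        ![EuclideanSpace.single i 1, EuclideanSpace.single i 1] =
      4 * (x - y) i ^ 2 * deriv (deriv G) (‖x - y‖ ^ 2) + 2 * deriv G (‖x - y‖ ^ 2) := by
    intro i
    rw [← deriv_deriv_comp_line hC]
    set a := ‖x - y‖ ^ 2 with ha
    set b := (x - y) i with hb
    have hq : ∀ t : ℝ, ‖x + t • EuclideanSpace.single i (1 : ℝ) - y‖ ^ 2 = a + 2 * b * t + t ^ 2 := by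
      intro t
      rw [show x + t • EuclideanSpace.single i (1 : ℝ) - y =
        (x - y) + t • EuclideanSpace.single i (1 : ℝ) by abel, norm_add_sq_real, inner_smul_right,
        EuclideanSpace.inner_single_right, norm_smul, mul_pow]
      simp [← hb, ← ha]
      ring
    simp only [hq]
    have hqd : ∀ t : ℝ, HasDerivAt (fun t : ℝ => a + 2 * b * t + t ^ 2) (2 * b + 2 * t) t := by
      intro t
      exact ((((hasDerivAt_id' t).const_mul (2 * b)).const_add a).add
        (hasDerivAt_pow 2 t)).congr_deriv (by simp)
    have htend : Tendsto (fun t : ℝ => a + 2 * b * t + t ^ 2) (𝓝 0) (𝓝 a) := by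
      simpa using (hqd 0).continuousAt.tendsto
    have hfirst : deriv (fun t : ℝ => G (a + 2 * b * t + t ^ 2)) =ᶠ[𝓝 0]
        fun t => deriv G (a + 2 * b * t + t ^ 2) * (2 * b + 2 * t) := by
      filter_upwards [htend.eventually (hG.eventually (by simp))] with t ht
      exact ((ht.differentiableAt (by simp)).hasDerivAt.comp t (hqd t)).deriv
    rw [hfirst.deriv_eq]
    have hG' : HasDerivAt (deriv G) (deriv (deriv G) a) (a + 2 * b * 0 + 0 ^ 2) := by
      simp only [mul_zero, add_zero, ne_eq, OfNat.ofNat_ne_zero, not_false_eq_true, zero_pow]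
      exact ((hG.derivWithin (m := 1) (by norm_num)).differentiableAt (by simp)).hasDerivAt
    have hlin : HasDerivAt (fun t : ℝ => 2 * b + 2 * t) 2 0 := by
      simpa using ((hasDerivAt_id (0 : ℝ)).const_mul 2).const_add (2 * b)
    have := ((hG'.comp 0 (hqd 0)).mul hlin).deriv
    simp only [Function.comp_def] at this
    refine this.trans ?_
    simp
    ring
  simp only [lap, hcoord]
  rw [EuclideanSpace.norm_sq_eq]
  simp [Fin.sum_univ_three]
  ring

/-- An entire function `g` with `sin r = r * g (r ^ 2)`. -/
theorem exists_sin_eq_mul_comp_sq :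
    ∃ g : ℝ → ℝ, ContDiff ℝ 2 g ∧ (∀ r, Real.sin r = r * g (r ^ 2)) ∧ g 0 = 1 := by
  let c : ℕ → ℝ := fun n => (-1) ^ n / (2 * n + 1).factorial
  let p := FormalMultilinearSeries.ofScalars ℝ c
  have hrad : p.radius = ⊤ := by
    refine FormalMultilinearSeries.ofScalars_radius_eq_top_of_tendsto ℝ c
      (Eventually.of_forall fun n => by simp [c, Nat.factorial_ne_zero]) ?_
    have : ∀ n : ℕ, ‖c n.succ‖ / ‖c n‖ = ((2 * n + 2 : ℝ) * (2 * n + 3))⁻¹ := by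
      intro n
      have : (2 * n.succ + 1).factorial = (2 * n + 3) * ((2 * n + 2) * (2 * n + 1).factorial) := by
        rw [show 2 * n.succ + 1 = (2 * n + 1) + 1 + 1 by simp; ring, Nat.factorial_succ,
          Nat.factorial_succ]
      have hne : ((2 * n + 1).factorial : ℝ) ≠ 0 := by positivity
      simp only [c, norm_div, norm_pow, norm_neg, norm_one, one_pow, this]
      push_cast
      rw [Real.norm_of_nonneg (by positivity), Real.norm_of_nonneg (by positivity)]
      field_simp
    simp only [this]
    refine tendsto_inv_atTop_zero.comp ?_
    refine tendsto_atTop_mono (fun n : ℕ => ?_) tendsto_natCast_atTop_atTop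
    have : (0 : ℝ) ≤ n := by positivity
    nlinarith
  have hball : HasFPowerSeriesOnBall p.sum p 0 ⊤ := by
    rw [← hrad]
    exact p.hasFPowerSeriesOnBall (by simp [hrad])
  have hsum : ∀ s : ℝ, HasSum (fun n => c n * s ^ n) (p.sum s) := by
    intro s
    have := hball.hasSum (y := s) (by simp)
    simpa [p, FormalMultilinearSeries.ofScalars_apply_eq, mul_comm] using this
  refine ⟨p.sum, ?_, fun r => ?_, ?_⟩
  · refine contDiff_iff_contDiffAt.2 fun s => ?_
    exact (hball.analyticAt_of_mem (by simp)).contDiffAt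
  · refine (Real.hasSum_sin r).unique ?_
    have hterm : (fun n : ℕ => (-1) ^ n * r ^ (2 * n + 1) / ((2 * n + 1).factorial : ℝ)) =
        fun n => r * (c n * (r ^ 2) ^ n) := by
      funext n
      simp only [c]
      ring
    rw [hterm]
    exact (hsum (r ^ 2)).mul_left r
  · refine (hsum 0).unique ?_
    convert hasSum_single (f := fun n => c n * (0 : ℝ) ^ n) 0 (fun n hn => by simp [hn]) using 1
    simp [c]

theorem ode_of_sin_eq_mul_comp_sq {g : ℝ → ℝ} (hg : ContDiff ℝ 2 g)
    (hsin : ∀ r, Real.sin r = r * g (r ^ 2)) {s : ℝ} (hs : 0 ≤ s) :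
    4 * s * deriv (deriv g) s + 6 * deriv g s = -g s := by
  have hg' : ContDiff ℝ 1 (deriv g) := hg.deriv'
  have hg'' : Continuous (deriv (deriv g)) := hg'.continuous_deriv_one
  have hd : ∀ r, HasDerivAt g (deriv g r) r := fun r => (hg.differentiable (by simp) r).hasDerivAt
  have hd' : ∀ r, HasDerivAt (deriv g) (deriv (deriv g) r) r :=
    fun r => (hg'.differentiable (by simp) r).hasDerivAt
  have hsq : ∀ r : ℝ, HasDerivAt (fun r : ℝ => r ^ 2) (2 * r) r := fun r => by
    simpa using hasDerivAt_pow 2 r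
  have h1 : ∀ r, Real.cos r = g (r ^ 2) + 2 * r ^ 2 * deriv g (r ^ 2) := by
    intro r
    have h := (hasDerivAt_id r).mul ((hd (r ^ 2)).comp r (hsq r))
    have h2 : HasDerivAt Real.sin _ r := h.congr_of_eventuallyEq (.of_forall hsin)
    rw [(Real.hasDerivAt_sin r).unique h2]
    simp
    ring
  have h2 : ∀ r : ℝ, 0 < r →
      4 * r ^ 2 * deriv (deriv g) (r ^ 2) + 6 * deriv g (r ^ 2) + g (r ^ 2) = 0 := by
    intro r hr
    have h := ((hd (r ^ 2)).comp r (hsq r)).add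
      (((hsq r).const_mul 2).mul ((hd' (r ^ 2)).comp r (hsq r)))
    have h3 : HasDerivAt Real.cos _ r := h.congr_of_eventuallyEq (.of_forall h1)
    have h4 := (Real.hasDerivAt_cos r).unique h3
    rw [hsin] at h4
    simp only [Function.comp_apply] at h4
    refine mul_left_cancel₀ hr.ne' ?_
    linear_combination -h4
  have hclosed : IsClosed {s : ℝ | 4 * s * deriv (deriv g) s + 6 * deriv g s + g s = 0} :=
    isClosed_eq (by have := hg.continuous; have := hg'.continuous; fun_prop) continuous_const
  have hsub : Set.Ioi (0 : ℝ) ⊆ {s : ℝ | 4 * s * deriv (deriv g) s + 6 * deriv g s + g s = 0} := by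
    intro s hs
    have := h2 (√s) (Real.sqrt_pos.2 hs)
    rwa [Real.sq_sqrt (le_of_lt hs)] at this
  have := hclosed.closure_subset_iff.2 hsub (by rwa [closure_Ioi])
  linarith [this.out]

theorem exists_sinc_eq_comp_sq : ∃ g : ℝ → ℝ, ContDiff ℝ 2 g ∧ (∀ r, Real.sinc r = g (r ^ 2)) ∧
    ∀ s, 0 ≤ s → 4 * s * deriv (deriv g) s + 6 * deriv g s = -g s := by
  obtain ⟨g, hg, hsin, h0⟩ := exists_sin_eq_mul_comp_sq
  refine ⟨g, hg, fun r => ?_, fun s hs => ode_of_sin_eq_mul_comp_sq hg hsin hs⟩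
  rcases eq_or_ne r 0 with rfl | hr
  · simp [h0]
  · rw [Real.sinc_of_ne_zero hr, hsin]
    field_simp

theorem contDiff_sinc_norm (k : ℝ) :
    ContDiff ℝ 2 fun x : EuclideanSpace ℝ (Fin 3) => Real.sinc (k * ‖x‖) := by
  obtain ⟨g, hg, hsinc, -⟩ := exists_sinc_eq_comp_sq
  simp only [hsinc, mul_pow]
  exact hg.comp (contDiff_const.mul (contDiff_norm_sq ℝ))

/-- `sinc (k‖x‖)` is an eigenfunction of the Laplacian on `ℝ³`. -/
theorem lap_sinc_norm (k : ℝ) (x : EuclideanSpace ℝ (Fin 3)) :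
    lap (fun x => Real.sinc (k * ‖x‖)) x = -k ^ 2 * Real.sinc (k * ‖x‖) := by
  obtain ⟨g, hg, hsinc, hode⟩ := exists_sinc_eq_comp_sq
  have hG : ContDiff ℝ 2 fun s => g (k ^ 2 * s) := hg.comp (contDiff_const.mul contDiff_id)
  have h := lap_comp_norm_sq x 0 hG.contDiffAt
  have hlin : ∀ s : ℝ, HasDerivAt (fun s : ℝ => k ^ 2 * s) (k ^ 2) s := fun s => by
    simpa using (hasDerivAt_id' s).const_mul (k ^ 2)
  have hd : deriv (fun s => g (k ^ 2 * s)) = fun s => deriv g (k ^ 2 * s) * k ^ 2 := funext fun s =>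
    ((hg.differentiable (by simp) _).hasDerivAt.comp s (hlin s)).deriv
  have hd' : deriv (deriv fun s => g (k ^ 2 * s)) =
      fun s => deriv (deriv g) (k ^ 2 * s) * k ^ 2 * k ^ 2 := by
    rw [hd]
    exact funext fun s => (((hg.differentiable_deriv_two _).hasDerivAt.comp s
      (hlin s)).mul_const (k ^ 2)).deriv
  rw [hd', hd] at h
  simp only [sub_zero] at h
  simp only [hsinc, mul_pow, h]
  linear_combination k ^ 2 * hode (k ^ 2 * ‖x‖ ^ 2) (by positivity)

theorem sinc_pos_of_lt_pi {x : ℝ} (h0 : 0 ≤ x) (hx : x < π) : 0 < Real.sinc x := by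
  rcases h0.eq_or_lt with rfl | h
  · simp
  · rw [Real.sinc_of_ne_zero h.ne']
    exact div_pos (Real.sin_pos_of_pos_of_lt_pi h hx) h

/-- A Dirichlet eigenfunction with eigenvalue `α` on a ball forces `β ≤ α` for each eigenvalue `β`
admitting an eigenfunction that is positive on the closed ball. -/
theorem eigenvalue_le_of_pos {f g : EuclideanSpace ℝ (Fin 3) → ℝ} {ρ α β : ℝ} (hρ : 0 < ρ)
    (hf : ContinuousOn f (Metric.closedBall 0 ρ)) (hg : ContinuousOn g (Metric.closedBall 0 ρ))
    (hf2 : ∀ x ∈ Metric.ball 0 ρ, ContDiffAt ℝ 2 f x)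
    (hg2 : ∀ x ∈ Metric.ball 0 ρ, ContDiffAt ℝ 2 g x)
    (hgpos : ∀ x ∈ Metric.closedBall 0 ρ, 0 < g x) (hf0 : 0 < f 0)
    (hfb : ∀ x ∈ Metric.sphere 0 ρ, f x = 0)
    (hflap : ∀ x ∈ Metric.ball 0 ρ, lap f x = -α * f x)
    (hglap : ∀ x ∈ Metric.ball 0 ρ, lap g x = -β * g x) : β ≤ α := by
  obtain ⟨x, hx, hmax⟩ := (isCompact_closedBall (0 : EuclideanSpace ℝ (Fin 3)) ρ).exists_isMaxOn
    ⟨0, Metric.mem_closedBall_self hρ.le⟩ (hf.div hg fun x hx => (hgpos x hx).ne')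
  have h0 : 0 < f 0 / g 0 := div_pos hf0 (hgpos 0 (Metric.mem_closedBall_self hρ.le))
  have hxpos : 0 < f x / g x := h0.trans_le (hmax (Metric.mem_closedBall_self hρ.le))
  have hgx := hgpos x hx
  have hfx : 0 < f x := by
    have := mul_pos hxpos hgx
    rwa [div_mul_cancel₀ _ hgx.ne'] at this
  have hxb : x ∈ Metric.ball (0 : EuclideanSpace ℝ (Fin 3)) ρ := by
    exact lt_of_le_of_ne (Metric.mem_closedBall.1 hx) fun h => hfx.ne' (hfb x h)
  set t := f x / g x with ht
  have hmin : IsLocalMin (fun y => t * g y - f y) x := by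
    filter_upwards [Metric.isOpen_ball.mem_nhds hxb] with y hy
    have hy' := Metric.ball_subset_closedBall hy
    have h1 : f y / g y ≤ t := hmax hy'
    rw [div_le_iff₀ (hgpos y hy')] at h1
    have h2 : t * g x = f x := div_mul_cancel₀ _ hgx.ne'
    linarith
  have hnn := hmin.lap_nonneg ((contDiffAt_const.mul (hg2 x hxb)).sub (hf2 x hxb))
  rw [lap_sub (contDiffAt_const.mul (hg2 x hxb)) (hf2 x hxb), lap_const_mul t (hg2 x hxb),
    hflap x hxb, hglap x hxb] at hnn
  have h2 : t * g x = f x := div_mul_cancel₀ _ hgx.ne'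
  have h3 : 0 ≤ (α - β) * f x := by rw [← h2] at hnn ⊢; linarith
  linarith [nonneg_of_mul_nonneg_left h3 hfx]

theorem lap_inv_norm_sq {x y : EuclideanSpace ℝ (Fin 3)} (h : 0 < ‖x - y‖) (c d : ℝ) :
    ContDiffAt ℝ 2 (fun z => c * ((‖z - y‖ ^ 2)⁻¹ - d)) x ∧
      lap (fun z => c * ((‖z - y‖ ^ 2)⁻¹ - d)) x = 2 * c * ((‖x - y‖ ^ 2) ^ 2)⁻¹ := by
  have ha : ‖x - y‖ ^ 2 ≠ 0 := by positivity
  have hG : ContDiffAt ℝ 2 (fun s : ℝ => c * (s⁻¹ - d)) (‖x - y‖ ^ 2) :=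
    contDiffAt_const.mul ((contDiffAt_inv ℝ ha).sub contDiffAt_const)
  refine ⟨ContDiffAt.comp (g := fun s : ℝ => c * (s⁻¹ - d)) x hG ((contDiffAt_id.sub contDiffAt_const).norm_sq ℝ), ?_⟩
  rw [lap_comp_norm_sq x y hG]
  set a := ‖x - y‖ ^ 2
  have hd : ∀ s : ℝ, s ≠ 0 → deriv (fun s : ℝ => c * (s⁻¹ - d)) s = c * -(s ^ 2)⁻¹ := fun s hs =>
    (((hasDerivAt_inv hs).sub_const d).const_mul c).deriv
  have hd' : deriv (deriv fun s : ℝ => c * (s⁻¹ - d)) a = 2 * c * (a ^ 3)⁻¹ := by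
    have : deriv (fun s : ℝ => c * (s⁻¹ - d)) =ᶠ[𝓝 a] fun s => c * -(s ^ 2)⁻¹ := by
      filter_upwards [isOpen_ne.mem_nhds ha] with s hs using hd s hs
    rw [this.deriv_eq]
    refine ((((hasDerivAt_pow 2 a).fun_inv (by positivity)).fun_neg).const_mul c).deriv.trans ?_
    simp
    field_simp
  rw [hd', hd a ha]
  field_simp
  ring

/-- Hopf's lemma: a nonnegative superharmonic function on a closed ball that is positive at the
center dominates a multiple of the distance to the boundary. -/
theorem exists_mul_dist_le_of_lap_nonpos {v : EuclideanSpace ℝ (Fin 3) → ℝ}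
    {y : EuclideanSpace ℝ (Fin 3)} {ρ : ℝ} (hρ : 0 < ρ)
    (hv : ContinuousOn v (Metric.closedBall y ρ))
    (hv2 : ∀ x ∈ Metric.ball y ρ, ContDiffAt ℝ 2 v x)
    (hlap : ∀ x ∈ Metric.ball y ρ, lap v x ≤ 0)
    (hnonneg : ∀ x ∈ Metric.closedBall y ρ, 0 ≤ v x) (hy : 0 < v y) :
    ∃ ε > 0, ∀ x ∈ Metric.closedBall y ρ, ε * (ρ - ‖x - y‖) ≤ v x := by
  set m := v y / 2
  have hmpos : 0 < m := by positivity
  obtain ⟨δ, hδ, hδv⟩ := Metric.eventually_nhds_iff_ball.1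
    ((hv2 y (Metric.mem_ball_self hρ)).continuousAt.eventually_const_lt (half_lt_self hy))
  set ρ₁ := min (δ / 2) (ρ / 2)
  have hρ₁ : 0 < ρ₁ := by positivity
  have hρ₁ρ : ρ₁ < ρ := (min_le_right _ _).trans_lt (half_lt_self hρ)
  have hinner : ∀ x, ‖x - y‖ ≤ ρ₁ → m < v x := fun x hx => hδv x <| by
    rw [mem_ball_iff_norm]
    exact hx.trans_lt ((min_le_left _ _).trans_lt (half_lt_self hδ))
  set c := m * ρ₁ ^ 2
  have hc : 0 < c := by positivity
  let h : EuclideanSpace ℝ (Fin 3) → ℝ := fun z => c * ((‖z - y‖ ^ 2)⁻¹ - (ρ ^ 2)⁻¹)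
  let A := Metric.closedBall y ρ \ Metric.ball y ρ₁
  have hA : IsCompact A := (isCompact_closedBall y ρ).diff Metric.isOpen_ball
  have hpos : ∀ z ∈ A, 0 < ‖z - y‖ := fun z hz => by
    have := hz.2
    rw [mem_ball_iff_norm, not_lt] at this
    linarith
  have hbarrier : ∀ x ∈ A, h x ≤ v x := by
    by_contra! hne
    obtain ⟨z, hzA, hz⟩ := hne
    have hcont : ContinuousOn (fun x => v x - h x) A :=
      (hv.mono Set.sdiff_subset).sub fun x hx =>
        (lap_inv_norm_sq (hpos x hx) c _).1.continuousAt.continuousWithinAt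
    obtain ⟨x, hxA, hmin⟩ := hA.exists_isMinOn ⟨z, hzA⟩ hcont
    have hx : v x - h x < 0 := (hmin hzA).trans_lt (by simpa using hz)
    have hxne : ‖x - y‖ ≠ ρ := fun he => by
      have h1 : h x = 0 := by simp [h, he]
      linarith [hnonneg x hxA.1]
    have hxne₁ : ‖x - y‖ ≠ ρ₁ := fun he => by
      have h1 : h x = m - c * (ρ ^ 2)⁻¹ := by
        simp only [h, he, c]
        field_simp
      have : 0 < c * (ρ ^ 2)⁻¹ := by positivity
      linarith [hinner x he.le]
    have hx₁ : ‖x - y‖ < ρ := lt_of_le_of_ne (mem_closedBall_iff_norm.1 hxA.1) hxne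
    have hx₂ : ρ₁ < ‖x - y‖ := by
      have := hxA.2
      rw [mem_ball_iff_norm, not_lt] at this
      exact lt_of_le_of_ne this hxne₁.symm
    have hxb : x ∈ Metric.ball y ρ := mem_ball_iff_norm.2 hx₁
    have hnhds : A ∈ 𝓝 x := by
      have hmem : {z | ρ₁ < ‖z - y‖ ∧ ‖z - y‖ < ρ} ∈ 𝓝 x :=
        ((isOpen_lt continuous_const (continuous_id.sub continuous_const).norm).inter
          (isOpen_lt (continuous_id.sub continuous_const).norm continuous_const)).mem_nhds
          ⟨hx₂, hx₁⟩
      filter_upwards [hmem] with z hz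
      exact ⟨mem_closedBall_iff_norm.2 hz.2.le, fun hh => (mem_ball_iff_norm.1 hh).not_gt hz.1⟩
    obtain ⟨hh2, hhlap⟩ := lap_inv_norm_sq (hpos x hxA) c (ρ ^ 2)⁻¹
    have hnn := (hmin.isLocalMin hnhds).lap_nonneg ((hv2 x hxb).sub hh2)
    rw [lap_sub (hv2 x hxb) hh2, hhlap] at hnn
    have := hpos x hxA
    have : 0 < 2 * c * ((‖x - y‖ ^ 2) ^ 2)⁻¹ := by positivity
    linarith [hlap x hxb]
  refine ⟨min (c / ρ ^ 3) (m / ρ), by positivity, fun x hx => ?_⟩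
  have hxρ : ‖x - y‖ ≤ ρ := mem_closedBall_iff_norm.1 hx
  by_cases hxA : ‖x - y‖ < ρ₁
  · calc min (c / ρ ^ 3) (m / ρ) * (ρ - ‖x - y‖) ≤ m / ρ * ρ := by
          gcongr
          · exact min_le_right _ _
          · linarith [norm_nonneg (x - y)]
      _ = m := by field_simp
      _ ≤ v x := (hinner x hxA.le).le
  · have hxA' : x ∈ A := ⟨hx, fun hh => hxA (mem_ball_iff_norm.1 hh)⟩
    have hr := hpos x hxA'
    refine le_trans ?_ (hbarrier x hxA')
    calc min (c / ρ ^ 3) (m / ρ) * (ρ - ‖x - y‖) ≤ c / ρ ^ 3 * (ρ - ‖x - y‖) := by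
          gcongr
          exact min_le_left _ _
      _ = c * ((ρ - ‖x - y‖) * ρ / (ρ ^ 2 * ρ ^ 2)) := by field_simp
      _ ≤ c * ((ρ - ‖x - y‖) * (ρ + ‖x - y‖) / (‖x - y‖ ^ 2 * ρ ^ 2)) := by
          have hd := sub_nonneg.2 hxρ
          gcongr
          linarith
      _ = h x := by
          simp only [h]
          field_simp
          ring

/-- The strong minimum principle on a ball. -/
theorem pos_of_lap_nonpos {v : EuclideanSpace ℝ (Fin 3) → ℝ} {R : ℝ}
    (hv2 : ∀ x ∈ Metric.ball 0 R, ContDiffAt ℝ 2 v x)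
    (hlap : ∀ x ∈ Metric.ball 0 R, lap v x ≤ 0)
    (hnonneg : ∀ x ∈ Metric.ball 0 R, 0 ≤ v x) {y : EuclideanSpace ℝ (Fin 3)}
    (hy : y ∈ Metric.ball 0 R) (hvy : 0 < v y) : ∀ x ∈ Metric.ball 0 R, 0 < v x := by
  set B := Metric.ball (0 : EuclideanSpace ℝ (Fin 3)) R
  have hv : ContinuousOn v B := fun x hx => (hv2 x hx).continuousAt.continuousWithinAt
  have hpos : IsOpen (B ∩ v ⁻¹' Set.Ioi 0) := hv.isOpen_inter_preimage Metric.isOpen_ball isOpen_Ioi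
  have hzero : IsOpen (B ∩ v ⁻¹' {0}) := by
    refine Metric.isOpen_iff.2 fun z hz => ?_
    have hzR : ‖z‖ < R := mem_ball_zero_iff.1 hz.1
    refine ⟨(R - ‖z‖) / 4, by linarith, fun w hw => ?_⟩
    rw [mem_ball_iff_norm] at hw
    have hwz : ‖w‖ ≤ ‖z‖ + ‖w - z‖ := norm_le_norm_add_norm_sub' w z
    have hsub : Metric.closedBall w ((R - ‖z‖) / 2) ⊆ B := by
      intro x hx
      rw [mem_closedBall_iff_norm] at hx
      have := norm_le_norm_add_norm_sub' x w
      exact mem_ball_zero_iff.2 (by linarith)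
    have hsub' := Metric.ball_subset_closedBall.trans hsub
    have hwB : w ∈ B := hsub (Metric.mem_closedBall_self (by linarith))
    refine ⟨hwB, le_antisymm (not_lt.1 fun hvw => ?_) (hnonneg w hwB)⟩
    obtain ⟨ε, hε, hle⟩ := exists_mul_dist_le_of_lap_nonpos (by linarith) (hv.mono hsub)
      (fun x hx => hv2 x (hsub' hx)) (fun x hx => hlap x (hsub' hx))
      (fun x hx => hnonneg x (hsub hx)) hvw
    rw [norm_sub_rev] at hw
    have h1 := hle z (mem_closedBall_iff_norm.2 (by linarith))
    have h2 : 0 < ε * ((R - ‖z‖) / 2 - ‖z - w‖) := mul_pos hε (by linarith)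
    have h3 : v z = 0 := hz.2
    linarith
  have hBconn : IsPreconnected B := (convex_ball _ _).isPreconnected
  have hsub := hBconn.subset_left_of_subset_union hpos hzero
    (Set.disjoint_left.2 fun x hx hx' => (ne_of_gt hx.2.out : v x ≠ 0) hx'.2)
    (fun x hx => (hnonneg x hx).lt_or_eq.imp (fun h => ⟨hx, h⟩) fun h => ⟨hx, h.symm⟩)
    ⟨y, hy, hy, hvy⟩
  exact fun x hx => (hsub hx).2

theorem sinc_norm_le {k R r : ℝ} (hR : 0 < R) (hkR : k * R = π) (hr : 0 ≤ r) (hrR : r ≤ R) :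
    Real.sinc (k * r) ≤ 2 / R * (R - r) := by
  have hk : 0 < k := pos_of_mul_pos_left (hkR ▸ Real.pi_pos) hR.le
  rw [div_mul_eq_mul_div, le_div_iff₀ hR]
  rcases le_or_gt r (R / 2) with h | h
  · have := Real.sinc_le_one (k * r)
    nlinarith
  · have hr' : 0 < r := by linarith
    rw [Real.sinc_of_ne_zero (by positivity), ← Real.sin_pi_sub, ← hkR, ← mul_sub]
    have hsin := Real.sin_le (x := k * (R - r)) (mul_nonneg hk.le (by linarith))
    have : Real.sin (k * (R - r)) / (k * r) ≤ (R - r) / r := by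
      rw [div_le_div_iff₀ (by positivity) hr']
      nlinarith
    have h2 : (R - r) / r * R ≤ 2 * (R - r) := by
      rw [div_mul_eq_mul_div, div_le_iff₀ hr']
      nlinarith
    nlinarith

/-- The first Dirichlet eigenvalue of a ball in `ℝ³` is simple. -/
theorem eq_mul_sinc_norm {u : EuclideanSpace ℝ (Fin 3) → ℝ} {k R : ℝ} (hR : 0 < R)
    (hkR : k * R = π) (hcont : ContinuousOn u (Metric.closedBall 0 R))
    (hu2 : ∀ x ∈ Metric.ball 0 R, ContDiffAt ℝ 2 u x) (hpos : ∀ x ∈ Metric.ball 0 R, 0 < u x)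
    (hbdry : ∀ x ∈ Metric.sphere 0 R, u x = 0)
    (hlap : ∀ x ∈ Metric.ball 0 R, lap u x = -k ^ 2 * u x) :
    ∃ t, ∀ x ∈ Metric.ball 0 R, u x = t * Real.sinc (k * ‖x‖) := by
  have hk : 0 < k := pos_of_mul_pos_left (hkR ▸ Real.pi_pos) hR.le
  have hφ : ∀ x ∈ Metric.ball (0 : EuclideanSpace ℝ (Fin 3)) R, 0 < Real.sinc (k * ‖x‖) :=
    fun x hx => sinc_pos_of_lt_pi (by positivity)
      (hkR ▸ mul_lt_mul_of_pos_left (mem_ball_zero_iff.1 hx) hk)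
  have h0 : (0 : EuclideanSpace ℝ (Fin 3)) ∈ Metric.ball 0 R := Metric.mem_ball_self hR
  let T : Set ℝ := {t | ∀ x ∈ Metric.ball 0 R, t * Real.sinc (k * ‖x‖) ≤ u x}
  have hTne : T.Nonempty := ⟨0, fun x hx => by simpa using (hpos x hx).le⟩
  have hTbdd : BddAbove T := ⟨u 0, fun t ht => by simpa using ht 0 h0⟩
  set t := sSup T
  have hle : ∀ x ∈ Metric.ball 0 R, t * Real.sinc (k * ‖x‖) ≤ u x := fun x hx => by
    rw [← le_div_iff₀ (hφ x hx)]
    exact csSup_le hTne fun s hs => (le_div_iff₀ (hφ x hx)).2 (hs x hx)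
  refine ⟨t, ?_⟩
  by_contra! hne
  obtain ⟨y, hy, hvy⟩ := hne
  let v : EuclideanSpace ℝ (Fin 3) → ℝ := fun x => u x - t * Real.sinc (k * ‖x‖)
  have hφ2 : ∀ x, ContDiffAt ℝ 2 (fun x : EuclideanSpace ℝ (Fin 3) => Real.sinc (k * ‖x‖)) x :=
    fun x => (contDiff_sinc_norm k).contDiffAt
  have hv2 : ∀ x ∈ Metric.ball 0 R, ContDiffAt ℝ 2 v x := fun x hx =>
    (hu2 x hx).sub (contDiffAt_const.mul (hφ2 x))
  have hvnonneg : ∀ x ∈ Metric.ball 0 R, 0 ≤ v x := fun x hx => sub_nonneg.2 (hle x hx)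
  have hvlap : ∀ x ∈ Metric.ball 0 R, lap v x ≤ 0 := fun x hx => by
    have h : lap v x = -k ^ 2 * v x := by
      rw [lap_sub (hu2 x hx) (contDiffAt_const.mul (hφ2 x)), lap_const_mul t (hφ2 x), hlap x hx,
        lap_sinc_norm]
      simp only [v]
      ring
    nlinarith [hvnonneg x hx, mul_nonneg (sq_nonneg k) (hvnonneg x hx)]
  have hv0 : 0 < v 0 := pos_of_lap_nonpos hv2 hvlap hvnonneg hy
    (sub_pos.2 (lt_of_le_of_ne (hle y hy) hvy.symm)) 0 h0
  have hvb : ∀ x ∈ Metric.closedBall 0 R, 0 ≤ v x := fun x hx => by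
    rcases (mem_closedBall_zero_iff.1 hx).lt_or_eq with h | h
    · exact hvnonneg x (mem_ball_zero_iff.2 h)
    · simp [v, hbdry x (mem_sphere_zero_iff_norm.2 h), h, hkR, Real.sinc_of_ne_zero Real.pi_ne_zero]
  obtain ⟨ε, hε, hhopf⟩ := exists_mul_dist_le_of_lap_nonpos hR
    (hcont.sub (continuous_const.mul (contDiff_sinc_norm k).continuous).continuousOn) hv2 hvlap hvb
    hv0
  have hmem : t + ε * R / 2 ∈ T := fun x hx => by
    have h1 : ε * (R - ‖x - 0‖) ≤ u x - t * Real.sinc (k * ‖x‖) :=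
      hhopf x (Metric.ball_subset_closedBall hx)
    have h2 := sinc_norm_le hR hkR (norm_nonneg x) (mem_ball_zero_iff.1 hx).le
    have h3 : ε * R / 2 * Real.sinc (k * ‖x‖) ≤ ε * R / 2 * (2 / R * (R - ‖x‖)) := by gcongr
    have h4 : ε * R / 2 * (2 / R * (R - ‖x‖)) = ε * (R - ‖x‖) := by field_simp
    rw [sub_zero] at h1
    linarith
  have := le_csSup hTbdd hmem
  have : 0 < ε * R / 2 := by positivity
  linarith

/-- The radius of a ball is determined by its first Dirichlet eigenvalue. -/
theorem mul_radius_eq_pi {u : EuclideanSpace ℝ (Fin 3) → ℝ} {k R : ℝ} (hk : 0 < k) (hR : 0 < R)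
    (hcont : ContinuousOn u (Metric.closedBall 0 R))
    (hu2 : ∀ x ∈ Metric.ball 0 R, ContDiffAt ℝ 2 u x) (hpos : ∀ x ∈ Metric.ball 0 R, 0 < u x)
    (hbdry : ∀ x ∈ Metric.sphere 0 R, u x = 0)
    (hlap : ∀ x ∈ Metric.ball 0 R, lap u x = -k ^ 2 * u x) : k * R = π := by
  have hφ2 : ∀ l : ℝ, ContDiff ℝ 2 fun x : EuclideanSpace ℝ (Fin 3) => Real.sinc (l * ‖x‖) :=
    contDiff_sinc_norm
  rcases lt_trichotomy (k * R) π with h | h | h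
  · rw [← lt_div_iff₀ hR] at h
    obtain ⟨l, hkl, hl⟩ := exists_between h
    rw [lt_div_iff₀ hR] at hl
    have := eigenvalue_le_of_pos hR hcont (hφ2 l).continuous.continuousOn hu2
      (fun x _ => (hφ2 l).contDiffAt) (fun x hx => sinc_pos_of_lt_pi
        (mul_nonneg (by linarith) (norm_nonneg x)) (lt_of_le_of_lt
          (mul_le_mul_of_nonneg_left (mem_closedBall_zero_iff.1 hx) (by linarith)) hl))
      (hpos 0 (Metric.mem_ball_self hR)) hbdry (fun x hx => by rw [hlap x hx])
      (fun x _ => by rw [lap_sinc_norm])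
    nlinarith
  · exact h
  · rw [← div_lt_iff₀ hR] at h
    obtain ⟨l, hl, hlk⟩ := exists_between h
    have hl0 : 0 < l := (div_pos Real.pi_pos hR).trans hl
    have hρ : 0 < π / l := div_pos Real.pi_pos hl0
    have hρR : π / l < R := by
      rw [div_lt_iff₀ hl0]
      rwa [div_lt_iff₀ hR, mul_comm] at hl
    have hsub : Metric.closedBall (0 : EuclideanSpace ℝ (Fin 3)) (π / l) ⊆ Metric.ball 0 R :=
      Metric.closedBall_subset_ball hρR
    have hsub' := Metric.ball_subset_closedBall.trans hsub
    have := eigenvalue_le_of_pos hρ (hφ2 l).continuous.continuousOn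
      (hcont.mono (hsub.trans Metric.ball_subset_closedBall)) (fun x _ => (hφ2 l).contDiffAt)
      (fun x hx => hu2 x (hsub' hx)) (fun x hx => hpos x (hsub hx)) (by simp)
      (fun x hx => by
        rw [mem_sphere_zero_iff_norm.1 hx, mul_div_cancel₀ _ hl0.ne',
          Real.sinc_of_ne_zero Real.pi_ne_zero, Real.sin_pi, zero_div])
      (fun x _ => by rw [lap_sinc_norm]) (fun x hx => by rw [hlap x (hsub' hx)])
    nlinarith

/-- The linear Lane–Emden equation (`p = 1`): a positive Dirichlet solution of
`Δu + 4π u = 0` can only live on the ball of radius `√π/2`, where it is a multiple of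
`sin(2√π |x|)/|x|`. -/
theorem lane_emden_linear_case (R : ℝ) (hR : 0 < R)
    (u : EuclideanSpace ℝ (Fin 3) → ℝ)
    (hcont : ContinuousOn u (closure (Metric.ball (0 : EuclideanSpace ℝ (Fin 3)) R)))
    (hC2 : ContDiffOn ℝ 2 u (Metric.ball (0 : EuclideanSpace ℝ (Fin 3)) R))
    (hpos : ∀ x ∈ Metric.ball (0 : EuclideanSpace ℝ (Fin 3)) R, 0 < u x)
    (hbdry : ∀ x ∈ Metric.sphere (0 : EuclideanSpace ℝ (Fin 3)) R, u x = 0)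
    (heq : ∀ x ∈ Metric.ball (0 : EuclideanSpace ℝ (Fin 3)) R, lap u x + 4 * π * u x = 0) :
    R = Real.sqrt π / 2 ∧
      ∃ C : ℝ, 0 < C ∧
        (∀ x ∈ Metric.ball (0 : EuclideanSpace ℝ (Fin 3)) R, x ≠ 0 →
          u x = C * Real.sin (2 * Real.sqrt π * ‖x‖) / ‖x‖) ∧
        u 0 = 2 * Real.sqrt π * C := by
  rw [closure_ball _ hR.ne'] at hcont
  have hu2 : ∀ x ∈ Metric.ball 0 R, ContDiffAt ℝ 2 u x := fun x hx =>
    hC2.contDiffAt (Metric.isOpen_ball.mem_nhds hx)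
  have hk : 0 < 2 * √π := by positivity
  have hsq : √π ^ 2 = π := Real.sq_sqrt Real.pi_pos.le
  have hlap : ∀ x ∈ Metric.ball 0 R, lap u x = -(2 * √π) ^ 2 * u x := fun x hx => by
    linear_combination heq x hx + 4 * u x * hsq
  have hkR := mul_radius_eq_pi hk hR hcont hu2 hpos hbdry hlap
  obtain ⟨t, ht⟩ := eq_mul_sinc_norm hR hkR hcont hu2 hpos hbdry hlap
  have h0 : u 0 = t := by simpa using ht 0 (Metric.mem_ball_self hR)
  have htpos : 0 < t := h0 ▸ hpos 0 (Metric.mem_ball_self hR)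
  refine ⟨mul_left_cancel₀ hk.ne' ?_, t / (2 * √π), by positivity, fun x hx hx0 => ?_, ?_⟩
  · linear_combination hkR - hsq
  · have : 0 < ‖x‖ := norm_pos_iff.2 hx0
    rw [ht x hx, Real.sinc_of_ne_zero (by positivity)]
    field_simp
  · rw [h0]
    field_simp
end

section
/- (Lichtenstein) Let 6/5 < γ < 2, let ρ₀ be a compactly supported nonnegative continuous radial Lane–Emden solution (i.e., ρ₀^{γ−1} − (1/|·| * ρ₀) is constant on {ρ₀ > 0}), and let ω₀ : [0,∞) → ℝ be a given smooth function. Then there exists κ̄ > 0 such that for each κ with |κ| < κ̄, there is a nonnegative, compactly supported, continuous function ρ_κ : ℝ³ → ℝ solving the rotating star equation ρ_κ^{γ−1}(x) − (1/|·| * ρ_κ)(x) − ∫₀^{r(x)} κ²ω₀²(s) s ds = constant for all x ∈ {ρ_κ > 0}, with ρ_0 = ρ₀ and with the map κ ↦ ρ_κ continuous from (−κ̄, κ̄) into the continuous functions on ℝ³ with the supremum norm. -/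
open MeasureTheory Real

/-- The Newtonian potential `(1/|·| * ρ)(x) = ∫ ρ(y)/|x−y| dy` on `ℝ³`. -/
noncomputable def pot (ρ : EuclideanSpace ℝ (Fin 3) → ℝ) (x : EuclideanSpace ℝ (Fin 3)) : ℝ :=
  ∫ y, ρ y / ‖x - y‖

/-- The cylindrical radius `r(x) = √(x₁² + x₂²)`. -/
noncomputable def cylRad (x : EuclideanSpace ℝ (Fin 3)) : ℝ :=
  Real.sqrt ((x 0)^2 + (x 1)^2)

namespace RotatingStar

open Metric Set

/-- Three-dimensional Euclidean space. -/
abbrev E3 := EuclideanSpace ℝ (Fin 3)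

lemma integrableOn_inv_norm_pow_ball {p : ℕ} (hp : p ≤ 2) :
    IntegrableOn (fun z : E3 => (‖z‖ ^ p)⁻¹) (ball 0 1) := by
  have := (integrableOn_fun_norm_addHaar (volume : Measure E3) (f := fun t : ℝ => (t ^ p)⁻¹)
    (r := 1)).2
  apply this
  have h : IntegrableOn (fun y : ℝ => y ^ (2 - p)) (Ioo 0 1) :=
    ((continuous_id.pow (2 - p)).integrableOn_Icc (a := 0) (b := 1)).mono_set Ioo_subset_Icc_self
  refine h.congr_fun (fun y hy => ?_) measurableSet_Ioo
  simp only [finrank_euclideanSpace, Fintype.card_fin, smul_eq_mul]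
  have hy0 : y ≠ 0 := hy.1.ne'
  rw [pow_sub₀ y hy0 hp]

lemma exists_kernel_bound {p : ℕ} (hp : p ≤ 2) (S : ℝ) :
    ∃ C : ℝ, 0 ≤ C ∧ ∀ x : E3,
      IntegrableOn (fun y : E3 => (‖x - y‖ ^ p)⁻¹) (closedBall 0 S) ∧
      ∫ y in closedBall (0 : E3) S, (‖x - y‖ ^ p)⁻¹ ≤ C := by
  set w : E3 → ℝ := (ball (0 : E3) 1).indicator (fun z => (‖z‖ ^ p)⁻¹) with hw
  have hwi : Integrable w := (integrable_indicator_iff measurableSet_ball).2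
    (integrableOn_inv_norm_pow_ball hp)
  have hw0 : ∀ z, 0 ≤ w z := fun z => indicator_nonneg (fun z _ => by positivity) z
  have hle : ∀ z : E3, (‖z‖ ^ p)⁻¹ ≤ w z + 1 := by
    intro z
    by_cases hz : z ∈ ball (0 : E3) 1
    · rw [hw, indicator_of_mem hz]; linarith
    · have h1 : 1 ≤ ‖z‖ := by simpa using hz
      have : (‖z‖ ^ p)⁻¹ ≤ 1 := inv_le_one_of_one_le₀ (one_le_pow₀ h1)
      linarith [hw0 z]
  have hone : IntegrableOn (fun _ : E3 => (1 : ℝ)) (closedBall 0 S) :=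
    integrableOn_const (isCompact_closedBall _ _).measure_lt_top.ne
  refine ⟨(∫ z, w z) + ∫ y in closedBall (0 : E3) S, (1 : ℝ), ?_, fun x => ?_⟩
  · have : 0 ≤ ∫ z, w z := integral_nonneg fun z => hw0 z
    have h2 : 0 ≤ ∫ y in closedBall (0 : E3) S, (1 : ℝ) := integral_nonneg (fun _ => zero_le_one)
    linarith
  have hwx : Integrable (fun y => w (x - y)) := hwi.comp_sub_left x
  have hmaj : IntegrableOn (fun y => w (x - y) + 1) (closedBall 0 S) := hwx.integrableOn.add hone
  have hInt : IntegrableOn (fun y : E3 => (‖x - y‖ ^ p)⁻¹) (closedBall 0 S) := by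
    refine hmaj.mono' ?_ ?_
    · exact (by fun_prop : Measurable fun y : E3 => (‖x - y‖ ^ p)⁻¹).aestronglyMeasurable
    · filter_upwards with y
      rw [Real.norm_of_nonneg (by positivity)]
      exact hle _
  refine ⟨hInt, (integral_mono hInt hmaj fun y => hle _).trans ?_⟩
  rw [integral_add hwx.integrableOn hone, ← integral_sub_left_eq_self w volume x]
  refine add_le_add (setIntegral_le_integral ?_ ?_) le_rfl
  · exact hwx
  · exact Filter.Eventually.of_forall fun y => hw0 (x - y)

/-- Measurable densities bounded by `M` and vanishing outside the closed ball of radius `S`. -/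
structure IsDensity (S M : ℝ) (f : E3 → ℝ) : Prop where
  meas : AEStronglyMeasurable f volume
  bound : ∀ y, |f y| ≤ M
  supp : ∀ y, S < ‖y‖ → f y = 0

namespace IsDensity

variable {S M M' : ℝ} {f g : E3 → ℝ}

lemma nonneg (hf : IsDensity S M f) : 0 ≤ M := (abs_nonneg _).trans (hf.bound 0)

lemma of_continuous (hf : Continuous f) (hS : ∀ y, S < ‖y‖ → f y = 0) :
    ∃ M, IsDensity S M f := by
  obtain ⟨M, hM⟩ := (isCompact_closedBall (0 : E3) S).exists_bound_of_continuousOn hf.continuousOn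
  refine ⟨max M 0, hf.aestronglyMeasurable, fun y => ?_, hS⟩
  by_cases hy : S < ‖y‖
  · simp [hS y hy]
  · exact (hM y (by simpa using hy)).trans (le_max_left _ _)

lemma mul_bounded (hf : IsDensity S M f) (hg : AEStronglyMeasurable g volume)
    (hb : ∀ y, |g y| ≤ M') : IsDensity S (M * M') (fun y => f y * g y) where
  meas := hf.meas.mul hg
  bound y := by rw [abs_mul]; exact mul_le_mul (hf.bound y) (hb y) (abs_nonneg _) hf.nonneg
  supp y hy := by simp [hf.supp y hy]

lemma add (hf : IsDensity S M f) (hg : IsDensity S M' g) :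
    IsDensity S (M + M') (fun y => f y + g y) where
  meas := hf.meas.add hg.meas
  bound y := (abs_add_le _ _).trans (add_le_add (hf.bound y) (hg.bound y))
  supp y hy := by simp [hf.supp y hy, hg.supp y hy]

lemma const_mul (hf : IsDensity S M f) (c : ℝ) : IsDensity S (|c| * M) (fun y => c * f y) where
  meas := hf.meas.const_mul c
  bound y := by rw [abs_mul]; exact mul_le_mul_of_nonneg_left (hf.bound y) (abs_nonneg _)
  supp y hy := by simp [hf.supp y hy]

lemma comp_isometry (hf : IsDensity S M f) (σ : E3 ≃ₗᵢ[ℝ] E3) :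
    IsDensity S M (fun y => f (σ y)) where
  meas := hf.meas.comp_measurePreserving σ.measurePreserving
  bound y := hf.bound _
  supp y hy := hf.supp _ (by simpa using hy)

lemma abs_div_le (hf : IsDensity S M f) (x y : E3) :
    |f y / ‖x - y‖| ≤ (closedBall (0 : E3) S).indicator (fun y => M * (‖x - y‖ ^ 1)⁻¹) y := by
  by_cases hy : y ∈ closedBall (0 : E3) S
  · rw [indicator_of_mem hy, abs_div, abs_norm, pow_one, ← div_eq_mul_inv]
    gcongr
    exact hf.bound y
  · rw [indicator_of_notMem hy, hf.supp y (by simpa using hy)]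
    simp

lemma integrable (hf : IsDensity S M f) : Integrable f := by
  have h : Integrable ((closedBall (0 : E3) S).indicator (fun _ => M)) :=
    (integrable_indicator_iff measurableSet_closedBall).2
      (integrableOn_const (isCompact_closedBall _ _).measure_lt_top.ne)
  refine h.mono' hf.meas ?_
  filter_upwards with y
  by_cases hy : y ∈ closedBall (0 : E3) S
  · rw [indicator_of_mem hy]
    exact hf.bound y
  · rw [indicator_of_notMem hy, hf.supp y (by simpa using hy)]
    simp

lemma integrable_div (hf : IsDensity S M f) (x : E3) : Integrable (fun y => f y / ‖x - y‖) := by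
  obtain ⟨C, -, hC⟩ := exists_kernel_bound (p := 1) (by norm_num) S
  have := (integrable_indicator_iff (measurableSet_closedBall (x := (0 : E3)) (ε := S))).2
    ((hC x).1.const_mul M)
  refine this.mono' ?_ ?_
  · exact (hf.meas.aemeasurable.div (by fun_prop)).aestronglyMeasurable
  · filter_upwards with y using hf.abs_div_le x y

end IsDensity

lemma exists_pot_bound (S : ℝ) : ∃ C : ℝ, 0 ≤ C ∧ ∀ (M : ℝ) (f : E3 → ℝ), IsDensity S M f →
    ∀ x, |pot f x| ≤ C * M := by
  obtain ⟨C, hC0, hC⟩ := exists_kernel_bound (p := 1) (by norm_num) S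
  refine ⟨C, hC0, fun M f hf x => ?_⟩
  have h1 : |pot f x| ≤ ∫ y, |f y / ‖x - y‖| := abs_integral_le_integral_abs
  have h2 := integral_mono (hf.integrable_div x).abs
    ((integrable_indicator_iff measurableSet_closedBall).2 ((hC x).1.const_mul M))
    (fun y => hf.abs_div_le x y)
  rw [integral_indicator measurableSet_closedBall, integral_const_mul] at h2
  have := mul_le_mul_of_nonneg_left (hC x).2 hf.nonneg
  linarith

lemma abs_inv_norm_sub_inv_norm_le (a b : E3) :
    a ≠ 0 → b ≠ 0 → |‖a‖⁻¹ - ‖b‖⁻¹| ≤ ‖a - b‖ * ((‖a‖ ^ 2)⁻¹ + (‖b‖ ^ 2)⁻¹) := by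
  intro ha hb
  have ha' : 0 < ‖a‖ := norm_pos_iff.2 ha
  have hb' : 0 < ‖b‖ := norm_pos_iff.2 hb
  have h1 : ‖a‖⁻¹ - ‖b‖⁻¹ = (‖b‖ - ‖a‖) * (‖a‖⁻¹ * ‖b‖⁻¹) := by field_simp
  rw [h1, abs_mul, abs_of_pos (show 0 < ‖a‖⁻¹ * ‖b‖⁻¹ by positivity)]
  apply mul_le_mul _ _ (by positivity) (norm_nonneg _)
  · rw [norm_sub_rev]; exact abs_norm_sub_norm_le b a
  · rw [← inv_pow, ← inv_pow]
    nlinarith [sq_nonneg (‖a‖⁻¹ - ‖b‖⁻¹), sq_nonneg ‖a‖⁻¹, sq_nonneg ‖b‖⁻¹]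

lemma exists_pot_lipschitz (S : ℝ) : ∃ C : ℝ, 0 ≤ C ∧ ∀ (M : ℝ) (f : E3 → ℝ), IsDensity S M f →
    ∀ x x', |pot f x - pot f x'| ≤ C * M * ‖x - x'‖ := by
  obtain ⟨C, hC0, hC⟩ := exists_kernel_bound (p := 2) le_rfl S
  refine ⟨2 * C, by positivity, fun M f hf x x' => ?_⟩
  have h0 : pot f x - pot f x' = ∫ y, (f y / ‖x - y‖ - f y / ‖x' - y‖) :=
    (integral_sub (hf.integrable_div x) (hf.integrable_div x')).symm
  rw [h0]
  refine abs_integral_le_integral_abs.trans ?_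
  have hmaj := (((hC x).1.add (hC x').1).const_mul (M * ‖x - x'‖))
  have h2 : ∫ y, |f y / ‖x - y‖ - f y / ‖x' - y‖| ≤
      ∫ y, (closedBall (0 : E3) S).indicator
        (fun y => M * ‖x - x'‖ * ((‖x - y‖ ^ 2)⁻¹ + (‖x' - y‖ ^ 2)⁻¹)) y := by
    refine integral_mono_ae ((hf.integrable_div x).sub (hf.integrable_div x')).abs
      ((integrable_indicator_iff measurableSet_closedBall).2 hmaj) ?_
    filter_upwards [compl_mem_ae_iff.2 (measure_singleton (μ := volume) x),
      compl_mem_ae_iff.2 (measure_singleton (μ := volume) x')] with y hy hy'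
    by_cases hyS : y ∈ closedBall (0 : E3) S
    · rw [indicator_of_mem hyS, div_eq_mul_inv, div_eq_mul_inv, ← mul_sub, abs_mul, mul_assoc]
      refine mul_le_mul (hf.bound y) ?_ (abs_nonneg _) hf.nonneg
      have := abs_inv_norm_sub_inv_norm_le (x - y) (x' - y)
        (sub_ne_zero.2 fun h => hy (by simp [h])) (sub_ne_zero.2 fun h => hy' (by simp [h]))
      rwa [sub_sub_sub_cancel_right] at this
    · rw [indicator_of_notMem hyS, hf.supp y (by simpa using hyS)]
      simp
  refine h2.trans ?_
  rw [integral_indicator measurableSet_closedBall, integral_const_mul,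
    integral_add (hC x).1 (hC x').1]
  have := mul_le_mul_of_nonneg_left (add_le_add (hC x).2 (hC x').2)
    (mul_nonneg hf.nonneg (norm_nonneg (x - x')))
  linarith

namespace IsDensity

variable {S M M' : ℝ} {f g : E3 → ℝ}

lemma continuous_pot (hf : IsDensity S M f) : Continuous (pot f) := by
  obtain ⟨C, hC0, hC⟩ := exists_pot_lipschitz S
  have : LipschitzWith (Real.toNNReal (C * M)) (pot f) := by
    refine LipschitzWith.of_dist_le_mul fun x y => ?_
    rw [Real.coe_toNNReal _ (mul_nonneg hC0 hf.nonneg), Real.dist_eq, dist_eq_norm]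
    exact hC M f hf x y
  exact this.continuous

lemma pot_add (hf : IsDensity S M f) (hg : IsDensity S M' g) (x : E3) :
    pot (fun y => f y + g y) x = pot f x + pot g x := by
  unfold pot
  rw [← integral_add (hf.integrable_div x) (hg.integrable_div x)]
  simp only [add_div]

lemma pot_sub (hf : IsDensity S M f) (hg : IsDensity S M' g) (x : E3) :
    pot (fun y => f y - g y) x = pot f x - pot g x := by
  unfold pot
  rw [← integral_sub (hf.integrable_div x) (hg.integrable_div x)]
  simp only [sub_div]

end IsDensity

lemma pot_const_mul (c : ℝ) (f : E3 → ℝ) (x : E3) :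
    pot (fun y => c * f y) x = c * pot f x := by
  unfold pot
  rw [← integral_const_mul]
  simp only [mul_div_assoc]

lemma pot_comp_isometry (f : E3 → ℝ) (σ : E3 ≃ₗᵢ[ℝ] E3) (x : E3) :
    pot (fun y => f (σ y)) x = pot f (σ x) := by
  unfold pot
  rw [← σ.measurePreserving.integral_comp σ.toHomeomorph.measurableEmbedding
    (fun y => f y / ‖σ x - y‖)]
  congr 1 with y
  rw [← map_sub, σ.norm_map]

/-- The Newtonian potential is a symmetric operator. -/
lemma IsDensity.integral_mul_pot_comm {S M M' : ℝ} {f g : E3 → ℝ}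
    (hf : IsDensity S M f) (hg : IsDensity S M' g) :
    ∫ x, f x * pot g x = ∫ x, g x * pot f x := by
  have hmeas : AEStronglyMeasurable (fun z : E3 × E3 => f z.1 * (g z.2 / ‖z.1 - z.2‖))
      (volume.prod volume) := by
    exact hf.meas.comp_fst.mul
      (hg.meas.comp_snd.aemeasurable.div (by fun_prop)).aestronglyMeasurable
  obtain ⟨C, hC0, hC⟩ := exists_pot_bound S
  have hgabs : IsDensity S M' (fun y => |g y|) :=
    ⟨hg.meas.norm, fun y => by rw [abs_abs]; exact hg.bound y, fun y hy => by simp [hg.supp y hy]⟩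
  have hInt : Integrable (Function.uncurry fun x y => f x * (g y / ‖x - y‖))
      (volume.prod volume) := by
    refine (integrable_prod_iff hmeas).2 ⟨?_, ?_⟩
    · filter_upwards with x using (hg.integrable_div x).const_mul _
    · have : (fun x => ∫ y, ‖f x * (g y / ‖x - y‖)‖) =
          fun x => |f x| * pot (fun y => |g y|) x := by
        ext x
        simp only [norm_mul, Real.norm_eq_abs, integral_const_mul, abs_div, abs_norm, pot]
      change Integrable (fun x => ∫ y, ‖f x * (g y / ‖x - y‖)‖) volume
      rw [this]
      refine hf.integrable.abs.mul_bdd (c := C * M')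
        hgabs.continuous_pot.aestronglyMeasurable ?_
      filter_upwards with x using hC _ _ hgabs x
  have := integral_integral_swap hInt
  simp only [integral_const_mul] at this
  unfold pot
  rw [this]
  congr 1 with y
  rw [← integral_const_mul]
  congr 1 with x
  rw [norm_sub_rev]
  ring

end RotatingStar

namespace RotatingStar
open Metric Set

lemma isCompactOperator_of_lipschitz {α X : Type*} [MetricSpace α] [CompactSpace α]
    [NormedAddCommGroup X] [NormedSpace ℝ X] (T : X →L[ℝ] C(α, ℝ)) (C : ℝ)
    (hT : ∀ h x y, |T h x - T h y| ≤ C * ‖h‖ * dist x y) : IsCompactOperator T := by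
  refine (isCompactOperator_iff_image_closedBall_subset_compact T.toLinearMap one_pos).2 ?_
  set e := ContinuousMap.isometryEquivBoundedOfCompact α ℝ with he
  set A : Set (BoundedContinuousFunction α ℝ) := e '' (T '' closedBall 0 1) with hA
  have hcomp : IsCompact (closure A) := by
    refine BoundedContinuousFunction.arzela_ascoli (closedBall (0 : ℝ) ‖T‖)
      (isCompact_closedBall _ _) A ?_ ?_
    · rintro _ x ⟨_, ⟨h, hh, rfl⟩, rfl⟩
      have h1 : ‖T h x‖ ≤ ‖T h‖ := (T h).norm_coe_le_norm x
      have h2 : ‖T h‖ ≤ ‖T‖ * ‖h‖ := T.le_opNorm h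
      have h3 : ‖h‖ ≤ 1 := by simpa using hh
      simp only [mem_closedBall, dist_zero_right]
      exact h1.trans (h2.trans (mul_le_of_le_one_right T.opNorm_nonneg h3))
    · refine equicontinuous_of_continuity_modulus (fun t => |C| * t) ?_ _ ?_
      · have : Continuous fun t : ℝ => |C| * t := by fun_prop
        simpa using this.tendsto 0
      · rintro x y ⟨_, ⟨_, ⟨h, hh, rfl⟩, rfl⟩⟩
        have h3 : ‖h‖ ≤ 1 := by simpa using hh
        rw [Real.dist_eq]
        refine (hT h x y).trans ?_
        gcongr
        calc C * ‖h‖ ≤ |C| * ‖h‖ := by gcongr; exact le_abs_self C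
          _ ≤ |C| := mul_le_of_le_one_right (abs_nonneg _) h3
  refine ⟨e.symm '' closure A, hcomp.image e.symm.continuous, ?_⟩
  rintro _ ⟨h, hh, rfl⟩
  exact ⟨e (T h), subset_closure ⟨T h, ⟨h, hh, rfl⟩, rfl⟩, e.symm_apply_apply _⟩

/-- Extension by zero of a function on a closed ball. -/
noncomputable def zeroExt (S : ℝ) (h : closedBall (0 : E3) S → ℝ) : E3 → ℝ :=
  Function.extend Subtype.val h 0

lemma zeroExt_apply {S : ℝ} (h : closedBall (0 : E3) S → ℝ) (x : closedBall (0 : E3) S) :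
    zeroExt S h x = h x := Subtype.val_injective.extend_apply h 0 x

lemma zeroExt_of_mem {S : ℝ} (h : closedBall (0 : E3) S → ℝ) {x : E3}
    (hx : x ∈ closedBall (0 : E3) S) : zeroExt S h x = h ⟨x, hx⟩ := zeroExt_apply h ⟨x, hx⟩

lemma zeroExt_of_lt {S : ℝ} (h : closedBall (0 : E3) S → ℝ) {x : E3} (hx : S < ‖x‖) :
    zeroExt S h x = 0 :=
  Function.extend_apply' (f := Subtype.val) h 0 x fun ⟨y, hy⟩ => by
    have := mem_closedBall_zero_iff.1 y.2
    rw [hy] at this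
    linarith

lemma zeroExt_isDensity {S : ℝ} (h : C(closedBall (0 : E3) S, ℝ)) :
    IsDensity S ‖h‖ (zeroExt S h) where
  meas := ((MeasurableEmbedding.subtype_coe measurableSet_closedBall).measurable_extend
    h.continuous.measurable measurable_zero).aestronglyMeasurable
  bound y := by
    by_cases hy : y ∈ closedBall (0 : E3) S
    · rw [zeroExt_of_mem _ hy]; exact h.norm_coe_le_norm _
    · rw [zeroExt_of_lt _ (by simpa using hy)]; simp
  supp y hy := zeroExt_of_lt _ hy

/-- The Newtonian potential as an operator on continuous functions on a closed ball. -/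
noncomputable def potOp (S : ℝ) : C(closedBall (0 : E3) S, ℝ) →L[ℝ] C(closedBall (0 : E3) S, ℝ) :=
  LinearMap.mkContinuousOfExistsBound
    { toFun := fun h => ⟨fun x => pot (zeroExt S h) x,
        (zeroExt_isDensity h).continuous_pot.comp continuous_subtype_val⟩
      map_add' := fun h g => by
        ext x
        change pot (zeroExt S (h + g)) x = pot (zeroExt S h) x + pot (zeroExt S g) x
        rw [← (zeroExt_isDensity h).pot_add (zeroExt_isDensity g)]
        congr 1 with y
        by_cases hy : y ∈ closedBall (0 : E3) S
        · simp [zeroExt_of_mem _ hy]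
        · simp [zeroExt_of_lt _ (show S < ‖y‖ by simpa using hy)]
      map_smul' := fun c h => by
        ext x
        change pot (zeroExt S (c • h)) x = c * pot (zeroExt S h) x
        rw [← pot_const_mul]
        congr 1 with y
        by_cases hy : y ∈ closedBall (0 : E3) S
        · simp [zeroExt_of_mem _ hy]
        · simp [zeroExt_of_lt _ (show S < ‖y‖ by simpa using hy)] }
    (by
      obtain ⟨C, hC0, hC⟩ := exists_pot_bound S
      refine ⟨C, fun h => (ContinuousMap.norm_le _ (by positivity)).2 fun x => ?_⟩
      exact hC _ _ (zeroExt_isDensity h) x)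

lemma potOp_apply (S : ℝ) (h : C(closedBall (0 : E3) S, ℝ)) (x : closedBall (0 : E3) S) :
    potOp S h x = pot (zeroExt S h) x := rfl

lemma isCompactOperator_potOp (S : ℝ) : IsCompactOperator (potOp S) := by
  obtain ⟨C, hC0, hC⟩ := exists_pot_lipschitz S
  refine isCompactOperator_of_lipschitz _ C fun h x y => ?_
  rw [potOp_apply, potOp_apply, Subtype.dist_eq, dist_eq_norm]
  exact hC _ _ (zeroExt_isDensity h) x y

lemma exists_equiv_of_compact {X : Type*} [NormedAddCommGroup X] [NormedSpace ℝ X]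
    [CompleteSpace X] (K : X →L[ℝ] X) (hK : IsCompactOperator K)
    (hinj : ∀ h, K h = h → h = 0) :
    ∃ A : X ≃L[ℝ] X, (A : X →L[ℝ] X) = ContinuousLinearMap.id ℝ X - K := by
  rcases hK.hasEigenvalue_or_mem_resolventSet (one_ne_zero (α := ℝ)) with h | h
  · obtain ⟨v, hv⟩ := h.exists_hasEigenvector
    exact absurd (hinj v (by simpa using hv.apply_eq_smul)) hv.2
  · rw [spectrum.mem_resolventSet_iff] at h
    obtain ⟨u, hu⟩ := h
    refine ⟨ContinuousLinearEquiv.ofUnit u, ?_⟩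
    ext x
    change (u : X →L[ℝ] X) x = _
    rw [hu]
    simp

end RotatingStar

namespace RotatingStar
open Metric Set

/-- The equation of state `t ↦ max t 0 ^ a`, expressing density through enthalpy. -/
noncomputable def eos (a t : ℝ) : ℝ := max t 0 ^ a

/-- The derivative of the equation of state. -/
noncomputable def eosDeriv (a t : ℝ) : ℝ := a * max t 0 ^ (a - 1)

variable {a : ℝ}

lemma eos_of_nonpos (ha : 1 < a) {t : ℝ} (ht : t ≤ 0) : eos a t = 0 := by
  rw [eos, max_eq_right ht, Real.zero_rpow (by linarith)]

lemma eos_of_nonneg {t : ℝ} (ht : 0 ≤ t) : eos a t = t ^ a := by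
  rw [eos, max_eq_left ht]

lemma eos_nonneg (t : ℝ) : 0 ≤ eos a t := by unfold eos; positivity

lemma eos_pos_iff (ha : 1 < a) {t : ℝ} : 0 < eos a t ↔ 0 < t := by
  refine ⟨fun h => ?_, fun h => ?_⟩
  · by_contra! h'
    rw [eos_of_nonpos ha h'] at h
    exact h.false
  · rw [eos_of_nonneg h.le]; positivity

lemma eosDeriv_nonneg (ha : 1 < a) (t : ℝ) : 0 ≤ eosDeriv a t := by
  unfold eosDeriv
  have : 0 < a := by linarith
  positivity

lemma eosDeriv_of_nonpos (ha : 1 < a) {t : ℝ} (ht : t ≤ 0) : eosDeriv a t = 0 := by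
  rw [eosDeriv, max_eq_right ht, Real.zero_rpow (by linarith), mul_zero]

lemma eosDeriv_pos (ha : 1 < a) {t : ℝ} (ht : 0 < t) : 0 < eosDeriv a t := by
  rw [eosDeriv, max_eq_left ht.le]
  have : 0 < a := by linarith
  positivity

lemma eosDeriv_mul_self (ha : 1 < a) (t : ℝ) : eosDeriv a t * t = a * eos a t := by
  rcases le_or_gt t 0 with h | h
  · rw [eosDeriv_of_nonpos ha h, eos_of_nonpos ha h]; simp
  · rw [eosDeriv, eos_of_nonneg h.le, max_eq_left h.le, mul_assoc, ← Real.rpow_add_one h.ne']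
    simp

lemma continuous_eosDeriv (ha : 1 < a) : Continuous (eosDeriv a) := by
  unfold eosDeriv
  exact continuous_const.mul ((continuous_id.max continuous_const).rpow_const
    fun _ => Or.inr (by linarith))

lemma hasDerivAt_eos (ha : 1 < a) (t : ℝ) : HasDerivAt (eos a) (eosDeriv a t) t := by
  have hpow : ∀ s, HasDerivAt (fun x : ℝ => x ^ a) (a * s ^ (a - 1)) s :=
    fun s => Real.hasDerivAt_rpow_const (Or.inr ha.le)
  rcases lt_trichotomy t 0 with h | h | h
  · rw [eosDeriv_of_nonpos ha h.le]
    refine (hasDerivAt_const t (0 : ℝ)).congr_of_eventuallyEq ?_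
    filter_upwards [Iio_mem_nhds h] with s hs using eos_of_nonpos ha (le_of_lt hs)
  · subst h
    have h1 : HasDerivWithinAt (eos a) 0 (Ici 0) 0 := by
      have := (hpow 0).hasDerivWithinAt (s := Ici 0)
      rw [Real.zero_rpow (by linarith), mul_zero] at this
      exact this.congr (fun s hs => eos_of_nonneg hs) (eos_of_nonneg le_rfl)
    have h2 : HasDerivWithinAt (eos a) 0 (Iic 0) 0 :=
      (hasDerivWithinAt_const 0 _ (0 : ℝ)).congr (fun s hs => eos_of_nonpos ha hs)
        (eos_of_nonpos ha le_rfl)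
    rw [eosDeriv_of_nonpos ha le_rfl, ← hasDerivWithinAt_univ, ← Iic_union_Ici (a := (0 : ℝ))]
    exact h2.union h1
  · have : eosDeriv a t = a * t ^ (a - 1) := by rw [eosDeriv, max_eq_left h.le]
    rw [this]
    refine (hpow t).congr_of_eventuallyEq ?_
    filter_upwards [Ioi_mem_nhds h] with s hs using eos_of_nonneg (le_of_lt hs)

lemma continuous_eos (ha : 1 < a) : Continuous (eos a) :=
  continuous_iff_continuousAt.2 fun t => (hasDerivAt_eos ha t).continuousAt

lemma eos_eq_of_rpow_eq {γ ρ t : ℝ} (hγ : 1 < γ) (hρ : 0 ≤ ρ) (h : ρ ^ (γ - 1) = t) :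
    eos (1 / (γ - 1)) t = ρ := by
  have h0 : 0 ≤ t := h ▸ Real.rpow_nonneg hρ _
  rw [eos_of_nonneg h0, ← h, one_div, Real.rpow_rpow_inv hρ (by linarith)]

lemma eos_rpow {γ t : ℝ} (hγ : 1 < γ) (ht : 0 ≤ t) :
    eos (1 / (γ - 1)) t ^ (γ - 1) = t := by
  rw [eos_of_nonneg ht, one_div, Real.rpow_inv_rpow ht (by linarith)]

section Superposition

variable {α : Type*} [TopologicalSpace α] [CompactSpace α]

/-- Multiplication by a fixed continuous function. -/
noncomputable def mulOp (v : C(α, ℝ)) : C(α, ℝ) →L[ℝ] C(α, ℝ) := ContinuousLinearMap.mul ℝ _ v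

lemma mulOp_apply (v h : C(α, ℝ)) (x : α) : mulOp v h x = v x * h x := rfl

/-- Superposition operators by `C¹` functions are strictly differentiable. -/
lemma hasStrictFDerivAt_superposition (F F' : C(ℝ, ℝ)) (hF : ∀ t, HasDerivAt F (F' t) t)
    (u : C(α, ℝ)) :
    HasStrictFDerivAt (fun w : C(α, ℝ) => F.comp w) (mulOp (F'.comp u)) u := by
  refine .of_isLittleO (Asymptotics.isLittleO_iff.2 fun ε hε => ?_)
  have hK : IsCompact (Icc (-(‖u‖ + 1)) (‖u‖ + 1)) := isCompact_Icc
  have huc := hK.uniformContinuousOn_of_continuous F'.continuous.continuousOn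
  rw [Metric.uniformContinuousOn_iff] at huc
  obtain ⟨δ, hδ, hδ'⟩ := huc ε hε
  have hpos : 0 < min δ 1 := lt_min hδ one_pos
  filter_upwards [prod_mem_nhds (ball_mem_nhds u hpos) (ball_mem_nhds u hpos)] with ⟨p, q⟩ hpq
  obtain ⟨hp, hq⟩ := hpq
  simp only [mem_ball, dist_eq_norm] at hp hq
  refine (ContinuousMap.norm_le _ (by positivity)).2 fun x => ?_
  have hpx : |p x - u x| < min δ 1 := ((p - u).norm_coe_le_norm x).trans_lt hp
  have hqx : |q x - u x| < min δ 1 := ((q - u).norm_coe_le_norm x).trans_lt hq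
  have hux : |u x| ≤ ‖u‖ := u.norm_coe_le_norm x
  have hbd : ∀ s ∈ ball (u x) (min δ 1), ‖F' s - F' (u x)‖ ≤ ε := by
    intro s hs
    have hs' : |s - u x| < min δ 1 := by simpa [Real.dist_eq] using hs
    have h1 := (lt_min_iff.1 hs').2
    have h2 := (lt_min_iff.1 hs').1
    rw [abs_lt] at h1
    rw [abs_le] at hux
    exact (hδ' s ⟨by linarith, by linarith⟩ (u x) ⟨by linarith, by linarith⟩ h2).le
  have key := (convex_ball (u x) (min δ 1)).norm_image_sub_le_of_norm_hasDerivWithin_le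
    (f := fun s => F s - F' (u x) * s) (f' := fun s => F' s - F' (u x)) (C := ε)
    (fun s _ => (((hF s).sub ((hasDerivAt_id' s).const_mul (F' (u x)))).congr_deriv
      (by simp)).hasDerivWithinAt) hbd
    (show q x ∈ ball (u x) (min δ 1) by simpa [Real.dist_eq] using hqx)
    (show p x ∈ ball (u x) (min δ 1) by simpa [Real.dist_eq] using hpx)
  have h3 : ‖p x - q x‖ ≤ ‖p - q‖ := (p - q).norm_coe_le_norm x
  have h4 : (F.comp p - F.comp q - mulOp (F'.comp u) (p - q)) x =
      (F (p x) - F' (u x) * p x) - (F (q x) - F' (u x) * q x) := by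
    simp only [ContinuousMap.sub_apply, ContinuousMap.comp_apply, mulOp_apply]
    ring
  rw [h4]
  exact key.trans (mul_le_mul_of_nonneg_left h3 hε.le)

end Superposition

end RotatingStar

namespace RotatingStar
open Metric Set
open scoped ENNReal

/-- The coordinates `(y₃, (y₁, y₂))` of a point of Euclidean space. -/
def splitCoord (y : E3) : ℝ × (ℝ × ℝ) := (y 2, (y 0, y 1))

lemma measurePreserving_splitCoord : MeasurePreserving splitCoord volume volume := by
  have h1 := PiLp.volume_preserving_ofLp (Fin 3)
  have h2 := volume_preserving_piFinSuccAbove (fun _ : Fin 3 => ℝ) 2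
  have h3 := (MeasurePreserving.id (volume : Measure ℝ)).prod (volume_preserving_finTwoArrow ℝ)
  exact (h3.comp h2).comp h1

lemma lintegral_polar (g : ℝ → ℝ≥0∞) (hg : Measurable g) :
    ∫⁻ p : ℝ × ℝ, g (p.1 ^ 2 + p.2 ^ 2) =
      ∫⁻ s in Ioi (0 : ℝ), ENNReal.ofReal (2 * π * s) * g (s ^ 2) := by
  rw [← lintegral_comp_polarCoord_symm, polarCoord_target]
  have h : ∀ p : ℝ × ℝ, ENNReal.ofReal p.1 •
      g ((polarCoord.symm p).1 ^ 2 + (polarCoord.symm p).2 ^ 2) =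
      ENNReal.ofReal p.1 * g (p.1 ^ 2) := by
    intro p
    rw [polarCoord_symm_apply, smul_eq_mul]
    congr 2
    nlinarith [Real.sin_sq_add_cos_sq p.2]
  simp only [h]
  rw [Measure.volume_eq_prod, ← Measure.prod_restrict, lintegral_prod _ (by fun_prop)]
  refine lintegral_congr fun s => ?_
  simp only [lintegral_const, Measure.restrict_apply_univ, Real.volume_Ioo]
  rw [mul_comm, ← mul_assoc, ← ENNReal.ofReal_mul (by linarith [pi_pos])]
  congr 2
  ring

lemma lintegral_radius_change (z : ℝ) (g : ℝ → ℝ≥0∞) :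
    ∫⁻ r in Ioi |z|, ENNReal.ofReal (2 * π * r) * g r =
      ∫⁻ s in Ioi (0 : ℝ), ENNReal.ofReal (2 * π * s) * g (√(s ^ 2 + z ^ 2)) := by
  have himg : (fun s : ℝ => √(s ^ 2 + z ^ 2)) '' Ioi 0 = Ioi |z| := by
    ext r
    constructor
    · rintro ⟨s, hs, rfl⟩
      have hs : 0 < s := hs
      exact Real.lt_sqrt_of_sq_lt (by rw [sq_abs]; nlinarith)
    · intro hr
      have hr : |z| < r := hr
      have h0 : 0 ≤ |z| := abs_nonneg z
      have h1 : z ^ 2 < r ^ 2 := by rw [← sq_abs z]; nlinarith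
      refine ⟨√(r ^ 2 - z ^ 2), Real.sqrt_pos.2 (by linarith), ?_⟩
      simp only
      rw [Real.sq_sqrt (by linarith), sub_add_cancel, Real.sqrt_sq (by linarith)]
  have hderiv : ∀ s ∈ Ioi (0 : ℝ), HasDerivWithinAt (fun s : ℝ => √(s ^ 2 + z ^ 2))
      (s / √(s ^ 2 + z ^ 2)) (Ioi 0) s := by
    intro s hs
    have hs : 0 < s := hs
    have hne : s ^ 2 + z ^ 2 ≠ 0 := by positivity
    have h := (((hasDerivAt_pow 2 s).add_const (z ^ 2)).sqrt hne).hasDerivWithinAt (s := Ioi 0)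
    refine h.congr_deriv ?_
    have : √(s ^ 2 + z ^ 2) ≠ 0 := (Real.sqrt_pos.2 (by positivity)).ne'
    field_simp
    norm_num
  have hinj : InjOn (fun s : ℝ => √(s ^ 2 + z ^ 2)) (Ioi 0) := by
    intro s hs t ht hst
    have hs : 0 < s := hs
    have ht : 0 < t := ht
    have := (Real.sqrt_inj (by positivity) (by positivity)).1 hst
    exact (pow_left_inj₀ hs.le ht.le two_ne_zero).1 (by linarith)
  rw [← himg, lintegral_image_eq_lintegral_abs_deriv_mul measurableSet_Ioi hderiv hinj]
  refine setLIntegral_congr_fun measurableSet_Ioi fun s hs => ?_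
  have hs : 0 < s := hs
  have hsq : 0 < √(s ^ 2 + z ^ 2) := Real.sqrt_pos.2 (by positivity)
  rw [← mul_assoc, ← ENNReal.ofReal_mul (abs_nonneg _), abs_of_pos (by positivity)]
  congr 2
  field_simp

/-- Integration in terms of the radius and the height. -/
lemma lintegral_norm_coord (g : ℝ × ℝ → ℝ≥0∞) (hg : Measurable g) :
    ∫⁻ y : E3, g (‖y‖, y 2) =
      ∫⁻ z : ℝ, ∫⁻ r in Ioi |z|, ENNReal.ofReal (2 * π * r) * g (r, z) := by
  let G : ℝ × (ℝ × ℝ) → ℝ≥0∞ := fun p => g (√(p.2.1 ^ 2 + p.2.2 ^ 2 + p.1 ^ 2), p.1)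
  have hG : Measurable G := by fun_prop
  have h1 : ∀ y : E3, g (‖y‖, y 2) = G (splitCoord y) := by
    intro y
    rw [EuclideanSpace.norm_eq, Fin.sum_univ_three]
    simp [splitCoord, G]
  refine (lintegral_congr h1).trans ((measurePreserving_splitCoord.lintegral_comp hG).trans ?_)
  rw [Measure.volume_eq_prod, lintegral_prod _ hG.aemeasurable]
  refine lintegral_congr fun z => ?_
  have h2 := lintegral_polar (fun t => g (√(t + z ^ 2), z)) (by fun_prop)
  exact h2.trans (lintegral_radius_change z fun r => g (r, z)).symm

lemma integral_inv_sqrt {r a : ℝ} (hr : 0 < r) (ha : 0 < a) (hra : r ≠ a) :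
    ∫ z in (-r)..r, (√(r ^ 2 + a ^ 2 - 2 * a * z))⁻¹ = 2 * min r a / a := by
  have hpos : ∀ z ∈ uIcc (-r) r, 0 < r ^ 2 + a ^ 2 - 2 * a * z := by
    intro z hz
    rw [uIcc_of_le (by linarith)] at hz
    have : 0 < (r - a) ^ 2 := by
      have := sub_ne_zero.2 hra
      positivity
    nlinarith [hz.2]
  have hd : ∀ z ∈ uIcc (-r) r, HasDerivAt (fun z => -√(r ^ 2 + a ^ 2 - 2 * a * z) / a)
      ((√(r ^ 2 + a ^ 2 - 2 * a * z))⁻¹) z := by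
    intro z hz
    have h1 : HasDerivAt (fun z => r ^ 2 + a ^ 2 - 2 * a * z) (-(2 * a * 1)) z :=
      ((hasDerivAt_id' z).const_mul (2 * a)).const_sub _
    have h2 := ((h1.sqrt (hpos z hz).ne').neg).div_const a
    refine h2.congr_deriv ?_
    have := (Real.sqrt_pos.2 (hpos z hz)).ne'
    field_simp
  have hc : ContinuousOn (fun z => (√(r ^ 2 + a ^ 2 - 2 * a * z))⁻¹) (uIcc (-r) r) :=
    ContinuousOn.inv₀ (by fun_prop) fun z hz => (Real.sqrt_pos.2 (hpos z hz)).ne'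
  rw [intervalIntegral.integral_eq_sub_of_hasDerivAt hd hc.intervalIntegrable]
  have e1 : √(r ^ 2 + a ^ 2 - 2 * a * r) = |r - a| := by
    rw [← Real.sqrt_sq_eq_abs]; congr 1; ring
  have e2 : √(r ^ 2 + a ^ 2 - 2 * a * (-r)) = r + a := by
    rw [← Real.sqrt_sq (show 0 ≤ r + a by linarith)]; congr 1; ring
  rw [e1, e2]
  rcases le_total r a with h | h
  · rw [min_eq_left h, abs_of_nonpos (by linarith)]
    ring
  · rw [min_eq_right h, abs_of_nonneg (by linarith)]
    ring

lemma lintegral_inv_sqrt {r a : ℝ} (hr : 0 < r) (ha : 0 < a) (hra : r ≠ a) :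
    ∫⁻ z in Ioo (-r) r, ENNReal.ofReal ((√(r ^ 2 + a ^ 2 - 2 * a * z))⁻¹) =
      ENNReal.ofReal (2 * min r a / a) := by
  have hpos : ∀ z ∈ Icc (-r) r, 0 < r ^ 2 + a ^ 2 - 2 * a * z := by
    intro z hz
    have : 0 < (r - a) ^ 2 := by
      have := sub_ne_zero.2 hra
      positivity
    nlinarith [hz.2]
  have hc : ContinuousOn (fun z => (√(r ^ 2 + a ^ 2 - 2 * a * z))⁻¹) (Icc (-r) r) :=
    ContinuousOn.inv₀ (by fun_prop) fun z hz => (Real.sqrt_pos.2 (hpos z hz)).ne'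
  rw [← integral_inv_sqrt hr ha hra, intervalIntegral.integral_of_le (by linarith),
    ofReal_integral_eq_lintegral_ofReal, restrict_Ioo_eq_restrict_Ioc]
  · exact (hc.integrableOn_Icc).mono_set Ioc_subset_Icc_self
  · filter_upwards with z using by positivity

lemma norm_single_sub (a : ℝ) (y : E3) :
    ‖EuclideanSpace.single 2 a - y‖ = √(‖y‖ ^ 2 + a ^ 2 - 2 * a * y 2) := by
  rw [EuclideanSpace.norm_eq, EuclideanSpace.norm_eq, Real.sq_sqrt (by positivity),
    Fin.sum_univ_three, Fin.sum_univ_three]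
  congr 1
  simp
  ring

lemma lintegral_radial_div {ψ : ℝ → ℝ} (hψ : Measurable ψ) (hψ0 : ∀ r, 0 ≤ ψ r) {a : ℝ}
    (ha : 0 < a) :
    ∫⁻ y : E3, ENNReal.ofReal (ψ ‖y‖ / ‖EuclideanSpace.single 2 a - y‖) =
      ∫⁻ r in Ioi (0 : ℝ), ENNReal.ofReal (4 * π / a * (ψ r * r * min r a)) := by
  have h1 := lintegral_norm_coord
    (fun p => ENNReal.ofReal (ψ p.1 * (√(p.1 ^ 2 + a ^ 2 - 2 * a * p.2))⁻¹)) (by fun_prop)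
  simp only [norm_single_sub, div_eq_mul_inv] at h1 ⊢
  rw [h1]
  set K : ℝ → ℝ → ℝ≥0∞ := fun z r => ENNReal.ofReal (2 * π * r) *
    ENNReal.ofReal (ψ r * (√(r ^ 2 + a ^ 2 - 2 * a * z))⁻¹) with hK
  have h2 : ∀ z, ∫⁻ r in Ioi |z|, K z r = ∫⁻ r, (Ioi |z|).indicator (K z) r :=
    fun z => (lintegral_indicator measurableSet_Ioi _).symm
  change ∫⁻ z, ∫⁻ r in Ioi |z|, K z r = _
  simp only [h2]
  have hmeas : Measurable (Function.uncurry fun z r => (Ioi |z|).indicator (K z) r) := by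
    have : (Function.uncurry fun z r => (Ioi |z|).indicator (K z) r) =
        {p : ℝ × ℝ | |p.1| < p.2}.indicator (fun p => K p.1 p.2) := by
      ext p
      rfl
    rw [this]
    refine Measurable.indicator (by fun_prop) ?_
    exact measurableSet_lt (by fun_prop) (by fun_prop)
  rw [lintegral_lintegral_swap (f := fun z r => (Ioi |z|).indicator (K z) r) hmeas.aemeasurable,
    ← lintegral_indicator measurableSet_Ioi]
  refine lintegral_congr_ae ?_
  filter_upwards [compl_mem_ae_iff.2 (measure_singleton (μ := volume) a)] with r hra
  by_cases hr : 0 < r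
  · rw [indicator_of_mem (show r ∈ Ioi 0 from hr)]
    have h3 : ∀ z, (Ioi |z|).indicator (K z) r = (Ioo (-r) r).indicator (fun z => K z r) z := by
      intro z
      by_cases hz : |z| < r
      · rw [indicator_of_mem (show r ∈ Ioi |z| from hz),
          indicator_of_mem (show z ∈ Ioo (-r) r from abs_lt.1 hz)]
      · rw [indicator_of_notMem (show r ∉ Ioi |z| from hz),
          indicator_of_notMem (show z ∉ Ioo (-r) r from fun h => hz (abs_lt.2 h))]
    simp only [h3]
    rw [lintegral_indicator measurableSet_Ioo]
    have h4 : ∀ z, K z r = ENNReal.ofReal (2 * π * r * ψ r) *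
        ENNReal.ofReal ((√(r ^ 2 + a ^ 2 - 2 * a * z))⁻¹) := by
      intro z
      have := pi_pos
      simp only [hK]
      rw [← ENNReal.ofReal_mul (by positivity), ← ENNReal.ofReal_mul
        (mul_nonneg (by positivity) (hψ0 r))]
      congr 1
      ring
    simp only [h4]
    rw [lintegral_const_mul _ (by fun_prop), lintegral_inv_sqrt hr ha hra,
      ← ENNReal.ofReal_mul (mul_nonneg (by positivity) (hψ0 r))]
    congr 1
    ring
  · rw [indicator_of_notMem (show r ∉ Ioi 0 from hr)]
    rw [lintegral_eq_zero_iff' (by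
      exact (hmeas.comp (measurable_id.prodMk measurable_const)).aemeasurable)]
    filter_upwards with z
    rw [indicator_of_notMem]
    · rfl
    · intro h
      exact hr ((abs_nonneg z).trans_lt h)

end RotatingStar

namespace RotatingStar
open Metric Set
open scoped ENNReal

lemma exists_isometry_of_norm_eq {x y : E3} (h : ‖x‖ = ‖y‖) :
    ∃ σ : E3 ≃ₗᵢ[ℝ] E3, σ x = y :=
  ⟨(ℝ ∙ (x - y))ᗮ.reflection, Submodule.reflection_sub h⟩

lemma pot_radial_eq_of_norm_eq (φ : ℝ → ℝ) {x y : E3} (h : ‖x‖ = ‖y‖) :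
    pot (fun z => φ ‖z‖) x = pot (fun z => φ ‖z‖) y := by
  obtain ⟨σ, rfl⟩ := exists_isometry_of_norm_eq h
  rw [← pot_comp_isometry]
  simp

lemma radial_isDensity {φ : ℝ → ℝ} (hφ : Continuous φ) {S : ℝ} (hS : ∀ r, S < r → φ r = 0) :
    ∃ M, IsDensity S M (fun y => φ ‖y‖) :=
  IsDensity.of_continuous (by fun_prop) fun y hy => hS _ hy

lemma pot_radial_aux {ψ : ℝ → ℝ} (hψ : Continuous ψ) (hψ0 : ∀ r, 0 ≤ ψ r) {x : E3}
    (hx : x ≠ 0) :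
    pot (fun y => ψ ‖y‖) x = ∫ r in Ioi (0 : ℝ), 4 * π / ‖x‖ * (ψ r * r * min r ‖x‖) := by
  have ha : 0 < ‖x‖ := norm_pos_iff.2 hx
  have hx' : ‖x‖ = ‖(EuclideanSpace.single 2 ‖x‖ : E3)‖ := by simp
  rw [pot_radial_eq_of_norm_eq ψ hx', pot, integral_eq_lintegral_of_nonneg_ae,
    lintegral_radial_div hψ.measurable hψ0 ha, integral_eq_lintegral_of_nonneg_ae]
  · filter_upwards [self_mem_ae_restrict measurableSet_Ioi] with r hr
    have hr : 0 < r := hr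
    have := hψ0 r
    have := pi_pos
    simp only [Pi.zero_apply]
    positivity
  · exact (by fun_prop : Continuous fun r => 4 * π / ‖x‖ * (ψ r * r * min r ‖x‖)).aestronglyMeasurable
  · filter_upwards with y using div_nonneg (hψ0 _) (norm_nonneg _)
  · exact (by fun_prop : Measurable fun y : E3 => ψ ‖y‖ / ‖EuclideanSpace.single 2 ‖x‖ - y‖).aestronglyMeasurable

/-- Newton's shell theorem for a radial density. -/
lemma pot_radial {φ : ℝ → ℝ} (hφ : Continuous φ) {S : ℝ} (hS : ∀ r, S < r → φ r = 0) {x : E3}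
    (hx : x ≠ 0) :
    pot (fun y => φ ‖y‖) x = 4 * π * ((∫ s in 0..‖x‖, φ s * s ^ 2) / ‖x‖ +
      ∫ s in ‖x‖..S, φ s * s) := by
  have ha : 0 < ‖x‖ := norm_pos_iff.2 hx
  set a := ‖x‖ with hadef
  have hp := pot_radial_aux (ψ := fun r => max (φ r) 0) (by fun_prop) (fun r => le_max_right _ _) hx
  have hm := pot_radial_aux (ψ := fun r => max (-φ r) 0) (by fun_prop) (fun r => le_max_right _ _) hx
  obtain ⟨Mp, hMp⟩ := radial_isDensity (φ := fun r => max (φ r) 0) (S := S) (by fun_prop)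
    (fun r hr => by simp [hS r hr])
  obtain ⟨Mm, hMm⟩ := radial_isDensity (φ := fun r => max (-φ r) 0) (S := S) (by fun_prop)
    (fun r hr => by simp [hS r hr])
  have hsplit : ∀ r, φ r = max (φ r) 0 - max (-φ r) 0 := by
    intro r
    rcases le_total (φ r) 0 with h | h
    · rw [max_eq_right h, max_eq_left (by linarith)]; ring
    · rw [max_eq_left h, max_eq_right (by linarith)]; ring
  have hInt : ∀ ψ : ℝ → ℝ, Continuous ψ → (∀ r, S < r → ψ r = 0) →
      IntegrableOn (fun r => 4 * π / a * (ψ r * r * min r a)) (Ioi 0) := by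
    intro ψ hψ hψS
    have h1 : IntegrableOn (fun r => 4 * π / a * (ψ r * r * min r a)) (Icc 0 S) :=
      (by fun_prop : Continuous fun r => 4 * π / a * (ψ r * r * min r a)).integrableOn_Icc
    refine IntegrableOn.of_forall_sdiff_eq_zero h1 measurableSet_Ioi fun r hr => ?_
    have : S < r := by
      by_contra! h
      exact hr.2 ⟨le_of_lt hr.1, h⟩
    rw [hψS r this]
    simp
  have h1 : pot (fun y => φ ‖y‖) x = ∫ r in Ioi (0 : ℝ), 4 * π / a * (φ r * r * min r a) := by
    have e1 : pot (fun y => φ ‖y‖) x =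
        pot (fun y => max (φ ‖y‖) 0 - max (-φ ‖y‖) 0) x := by
      congr 1
      ext y
      exact hsplit _
    rw [e1, hMp.pot_sub hMm, hp, hm, ← integral_sub
      (hInt _ (by fun_prop) fun r hr => by simp [hS r hr])
      (hInt _ (by fun_prop) fun r hr => by simp [hS r hr])]
    congr 1 with r
    conv_rhs => rw [hsplit r]
    ring
  set T := max S a with hT
  have hcont : Continuous fun r => 4 * π / a * (φ r * r * min r a) := by fun_prop
  have h2 : ∫ r in Ioi (0 : ℝ), 4 * π / a * (φ r * r * min r a) =
      ∫ r in (0 : ℝ)..T, 4 * π / a * (φ r * r * min r a) := by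
    rw [intervalIntegral.integral_of_le (ha.le.trans (le_max_right _ _))]
    refine setIntegral_eq_of_subset_of_forall_sdiff_eq_zero measurableSet_Ioi
      (fun r hr => hr.1) fun r hr => ?_
    have : T < r := by
      by_contra! h
      exact hr.2 ⟨hr.1, h⟩
    rw [hS r ((le_max_left _ _).trans_lt this)]
    simp
  have h3 : ∫ r in (0 : ℝ)..a, 4 * π / a * (φ r * r * min r a) =
      4 * π * ((∫ s in 0..a, φ s * s ^ 2) / a) := by
    have : 4 * π * ((∫ s in 0..a, φ s * s ^ 2) / a) =
        4 * π / a * ∫ s in 0..a, φ s * s ^ 2 := by ring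
    rw [this, ← intervalIntegral.integral_const_mul]
    refine intervalIntegral.integral_congr fun r hr => ?_
    rw [uIcc_of_le ha.le] at hr
    simp only [min_eq_left hr.2]
    ring
  have h4 : ∫ r in a..T, 4 * π / a * (φ r * r * min r a) = 4 * π * ∫ s in a..T, φ s * s := by
    rw [← intervalIntegral.integral_const_mul]
    refine intervalIntegral.integral_congr fun r hr => ?_
    rw [uIcc_of_le (le_max_right _ _)] at hr
    simp only [min_eq_right hr.1]
    field_simp
  have hc2 : Continuous fun s => φ s * s := by fun_prop
  have h5 : ∫ s in S..T, φ s * s = 0 := by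
    rw [intervalIntegral.integral_of_le (le_max_left _ _)]
    refine setIntegral_eq_zero_of_forall_eq_zero fun r hr => ?_
    rw [hS r hr.1, zero_mul]
  rw [h1, h2, ← intervalIntegral.integral_add_adjacent_intervals (hcont.intervalIntegrable 0 a)
    (hcont.intervalIntegrable a T), h3, h4, ← intervalIntegral.integral_add_adjacent_intervals
    (hc2.intervalIntegrable a S) (hc2.intervalIntegrable S T), h5]
  ring

/-- The mass of a radial density inside the ball of radius `r`. -/
noncomputable def massFn (φ : ℝ → ℝ) (r : ℝ) : ℝ := 4 * π * ∫ s in 0..r, φ s * s ^ 2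

/-- The potential of a radial density as a function of the radius. -/
noncomputable def radialPot (φ : ℝ → ℝ) (S r : ℝ) : ℝ :=
  massFn φ r / r + 4 * π * ∫ s in r..S, φ s * s

lemma pot_eq_radialPot {φ : ℝ → ℝ} (hφ : Continuous φ) {S : ℝ} (hS : ∀ r, S < r → φ r = 0)
    {x : E3} (hx : x ≠ 0) : pot (fun y => φ ‖y‖) x = radialPot φ S ‖x‖ := by
  rw [pot_radial hφ hS hx, radialPot, massFn]
  ring

lemma hasDerivAt_massFn {φ : ℝ → ℝ} (hφ : Continuous φ) (r : ℝ) :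
    HasDerivAt (massFn φ) (4 * π * (φ r * r ^ 2)) r := by
  have hc : Continuous fun s => φ s * s ^ 2 := by fun_prop
  exact (intervalIntegral.integral_hasDerivAt_right (hc.intervalIntegrable 0 r)
    (hc.stronglyMeasurableAtFilter _ _) hc.continuousAt).const_mul _

lemma hasDerivAt_radialPot {φ : ℝ → ℝ} (hφ : Continuous φ) (S : ℝ) {r : ℝ} (hr : r ≠ 0) :
    HasDerivAt (radialPot φ S) (-massFn φ r / r ^ 2) r := by
  have hc : Continuous fun s => φ s * s := by fun_prop
  have h1 := (intervalIntegral.integral_hasDerivAt_left (hc.intervalIntegrable r S)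
    (hc.stronglyMeasurableAtFilter _ _) hc.continuousAt).const_mul (4 * π)
  refine (((hasDerivAt_massFn hφ r).div (hasDerivAt_id' r) hr).add h1).congr_deriv ?_
  field_simp
  ring

end RotatingStar

namespace RotatingStar
open Metric Set Filter Topology

lemma massFn_nonneg {φ : ℝ → ℝ} (h0 : ∀ r, 0 ≤ φ r) {r : ℝ} (hr : 0 ≤ r) : 0 ≤ massFn φ r := by
  have := intervalIntegral.integral_nonneg (μ := volume) (f := fun s => φ s * s ^ 2) hr
    fun s _ => mul_nonneg (h0 s) (sq_nonneg s)
  unfold massFn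
  positivity

lemma antitoneOn_radialPot {φ : ℝ → ℝ} (hφ : Continuous φ) (h0 : ∀ r, 0 ≤ φ r) (S : ℝ) :
    AntitoneOn (radialPot φ S) (Ioi 0) := by
  refine antitoneOn_of_deriv_nonpos (convex_Ioi 0) (fun r hr =>
    (hasDerivAt_radialPot hφ S (ne_of_gt hr)).continuousAt.continuousWithinAt)
    (fun r hr => (hasDerivAt_radialPot hφ S (ne_of_gt (interior_subset hr))
      ).differentiableAt.differentiableWithinAt) fun r hr => ?_
  have hr : 0 < r := interior_subset hr
  rw [(hasDerivAt_radialPot hφ S hr.ne').deriv, neg_div]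
  have := massFn_nonneg h0 hr.le
  have : 0 ≤ massFn φ r / r ^ 2 := by positivity
  linarith

/-- A compactly supported Lane–Emden star: `φ` is the radial profile of the density, `R` the
radius, and `Θ = 1/|·| * ρ + k` the enthalpy. -/
structure IsStar (a R k : ℝ) (φ : ℝ → ℝ) (Θ : E3 → ℝ) : Prop where
  one_lt : 1 < a
  radius_pos : 0 < R
  cont : Continuous φ
  pot_eq : ∀ x, Θ x = pot (fun y => φ ‖y‖) x + k
  eos_eq : ∀ x, eos a (Θ x) = φ ‖x‖
  pos : ∀ x, ‖x‖ < R → 0 < Θ x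
  zero : ∀ x, ‖x‖ = R → Θ x = 0
  neg : ∀ x, R < ‖x‖ → Θ x < 0

/-- A density positive at one radius is positive at all smaller radii. -/
lemma profile_pos_of_pos {φ T : ℝ → ℝ} {p : ℝ} (hp : 0 < p) (hφ : Continuous φ)
    (h0 : ∀ r, 0 ≤ φ r) (hT : AntitoneOn T (Ioi 0)) (heq : ∀ r, 0 < r → 0 < φ r → φ r ^ p = T r)
    {r₁ r₂ : ℝ} (h1 : 0 < φ r₁) (h2 : 0 ≤ r₂) (h12 : r₂ < r₁) : 0 < φ r₂ := by
  by_contra! hneg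
  set Z := Icc r₂ r₁ ∩ φ ⁻¹' {0} with hZ
  have hZc : IsCompact Z := isCompact_Icc.inter_right (isClosed_singleton.preimage hφ)
  have hZne : Z.Nonempty := ⟨r₂, ⟨le_rfl, h12.le⟩, le_antisymm hneg (h0 _)⟩
  obtain ⟨⟨hl, hu⟩, hz⟩ := hZc.sSup_mem hZne
  set r₃ := sSup Z with hr₃
  have hz : φ r₃ = 0 := hz
  have hlt : r₃ < r₁ := lt_of_le_of_ne hu fun h => by rw [← h, hz] at h1; exact h1.false
  have hpos : ∀ r ∈ Ioo r₃ r₁, 0 < φ r := fun r hr => by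
    refine lt_of_le_of_ne (h0 r) fun h => ?_
    have : r ≤ r₃ := le_csSup hZc.bddAbove ⟨⟨hl.trans hr.1.le, hr.2.le⟩, h.symm⟩
    exact absurd hr.1 (not_lt.2 this)
  have hlim : Tendsto (fun r => φ r ^ p) (𝓝[>] r₃) (𝓝 0) := by
    have hc : Continuous fun r => φ r ^ p := hφ.rpow_const fun _ => Or.inr hp.le
    have := (hc.tendsto r₃).mono_left (nhdsWithin_le_nhds (s := Ioi r₃))
    rwa [hz, zero_rpow hp.ne'] at this
  have hge : φ r₁ ^ p ≤ 0 := by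
    refine ge_of_tendsto hlim ?_
    filter_upwards [Ioo_mem_nhdsGT hlt] with r hr
    have hr0 : 0 < r := (h2.trans hl).trans_lt hr.1
    rw [heq r hr0 (hpos r hr), heq r₁ (hr0.trans hr.2) h1]
    exact hT hr0 (hr0.trans hr.2) hr.2.le
  exact absurd (rpow_pos_of_pos h1 p) (not_lt.2 hge)

/-- The support of a nontrivial radial Lane–Emden density is a ball. -/
lemma exists_isStar {γ : ℝ} (hγ₁ : 1 < γ) (hγ₂ : γ < 2) {ρ : E3 → ℝ} (hcont : Continuous ρ)
    (h0 : ∀ x, 0 ≤ ρ x) (hsupp : HasCompactSupport ρ) (hrad : ∀ x y : E3, ‖x‖ = ‖y‖ → ρ x = ρ y)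
    {k : ℝ} (hk : ∀ x, 0 < ρ x → ρ x ^ (γ - 1) - pot ρ x = k) (hne : ∃ x, ρ x ≠ 0) :
    ∃ R φ, (ρ = fun x => φ ‖x‖) ∧
      IsStar (1 / (γ - 1)) R k φ (fun x => pot (fun y => φ ‖y‖) x + k) := by
  have hp : 0 < γ - 1 := by linarith
  have ha : 1 < 1 / (γ - 1) := by rw [lt_div_iff₀ hp]; linarith
  set e : ℝ → E3 := fun r => EuclideanSpace.single 2 r with he
  have hen : ∀ r, ‖e r‖ = |r| := fun r => by simp [he]
  have hec : Continuous e := by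
    refine (Isometry.of_dist_eq fun r s => ?_).continuous
    simp [he]
  set φ : ℝ → ℝ := fun r => ρ (e r) with hφdef
  have hφ : Continuous φ := hcont.comp hec
  have hφ0 : ∀ r, 0 ≤ φ r := fun r => h0 _
  have hρφ : ∀ x, ρ x = φ ‖x‖ := fun x => hrad _ _ (by simp [hen])
  have hρ : ρ = fun x => φ ‖x‖ := funext hρφ
  obtain ⟨S, hS⟩ : ∃ S, ∀ r, S < r → φ r = 0 := by
    obtain ⟨S, hS⟩ := hsupp.isCompact.isBounded.subset_closedBall 0
    refine ⟨S, fun r hr => ?_⟩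
    by_contra h
    have := mem_closedBall_zero_iff.1 (hS (subset_tsupport _ h))
    rw [hen] at this
    linarith [le_abs_self r]
  set T : ℝ → ℝ := fun r => radialPot φ S r + k with hT
  have hpotT : ∀ x : E3, x ≠ 0 → pot (fun y => φ ‖y‖) x + k = T ‖x‖ := fun x hx => by
    rw [pot_eq_radialPot hφ hS hx]
  have heq3 : ∀ x, 0 < φ ‖x‖ → φ ‖x‖ ^ (γ - 1) = pot (fun y => φ ‖y‖) x + k := fun x hx => by
    have := hk x (by rwa [hρφ])
    rw [hρφ x, hρ] at this
    linarith
  have heq : ∀ r, 0 < r → 0 < φ r → φ r ^ (γ - 1) = T r := fun r hr hφr => by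
    have hn : ‖e r‖ = r := by rw [hen, abs_of_pos hr]
    have := heq3 (e r) (by rwa [hn])
    rw [hpotT (e r) (norm_pos_iff.1 (by rwa [hn])), hn] at this
    exact this
  have hTanti : AntitoneOn T (Ioi 0) := (antitoneOn_radialPot hφ hφ0 S).add_const k
  set P : Set ℝ := {r | 0 ≤ r ∧ 0 < φ r} with hP
  have hPne : P.Nonempty := by
    obtain ⟨x, hx⟩ := hne
    exact ⟨‖x‖, norm_nonneg _, by rw [← hρφ]; exact lt_of_le_of_ne (h0 x) (Ne.symm hx)⟩
  have hPb : BddAbove P := ⟨S, fun r hr => by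
    by_contra! h
    exact hr.2.ne' (hS r h)⟩
  set R := sSup P with hR
  have hR0 : 0 ≤ R := hPne.elim fun r hr => hr.1.trans (le_csSup hPb hr)
  have hout : ∀ r, R < r → φ r = 0 := fun r hr => by
    by_contra h
    have : r ≤ R := le_csSup hPb ⟨hR0.trans hr.le, lt_of_le_of_ne (hφ0 r) (Ne.symm h)⟩
    linarith
  have hφR : φ R = 0 := by
    have h1 : Tendsto φ (𝓝[>] R) (𝓝 (φ R)) := (hφ.tendsto R).mono_left nhdsWithin_le_nhds
    refine tendsto_nhds_unique h1 (tendsto_const_nhds.congr' ?_)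
    filter_upwards [self_mem_nhdsWithin] with r hr using (hout r hr).symm
  have hin : ∀ r, 0 ≤ r → r < R → 0 < φ r := fun r hr hrR => by
    obtain ⟨r₁, hr₁, hlt⟩ := exists_lt_of_lt_csSup hPne hrR
    exact profile_pos_of_pos hp hφ hφ0 hTanti heq hr₁.2 hr hlt
  have hRpos : 0 < R := by
    obtain ⟨r, hr⟩ := hPne
    refine lt_of_le_of_ne hR0 fun h => ?_
    have h1 : r ≤ R := le_csSup hPb hr
    have h2 : r = R := le_antisymm h1 (h ▸ hr.1)
    rw [h2] at hr
    exact hr.2.ne' hφR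
  have hmass : ∀ r, 0 < r → 0 < massFn φ r := fun r hr => by
    have : 0 < ∫ s in 0..r, φ s * s ^ 2 := by
      refine intervalIntegral.integral_pos hr (by fun_prop)
        (fun s _ => mul_nonneg (hφ0 s) (sq_nonneg s)) ⟨min r (R / 2), ⟨?_, min_le_left _ _⟩, ?_⟩
      · positivity
      · have h1 : 0 < min r (R / 2) := by positivity
        have := hin _ h1.le ((min_le_right _ _).trans_lt (by linarith))
        positivity
    unfold massFn
    positivity
  have hTstrict : StrictAntiOn T (Ioi 0) := by
    refine StrictAntiOn.add_const (strictAntiOn_of_deriv_neg (convex_Ioi 0) (fun r hr =>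
      (hasDerivAt_radialPot hφ S (ne_of_gt hr)).continuousAt.continuousWithinAt) fun r hr => ?_) k
    have hr : 0 < r := interior_subset hr
    rw [(hasDerivAt_radialPot hφ S hr.ne').deriv, neg_div]
    have := hmass r hr
    have : 0 < massFn φ r / r ^ 2 := by positivity
    linarith
  have hTR : T R = 0 := by
    have h1 : Tendsto T (𝓝[<] R) (𝓝 (T R)) :=
      (((hasDerivAt_radialPot hφ S hRpos.ne').continuousAt.add continuousAt_const).tendsto
        ).mono_left nhdsWithin_le_nhds
    have h2 : Tendsto (fun r => φ r ^ (γ - 1)) (𝓝[<] R) (𝓝 0) := by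
      have hc : Continuous fun r => φ r ^ (γ - 1) := hφ.rpow_const fun _ => Or.inr hp.le
      have := (hc.tendsto R).mono_left (nhdsWithin_le_nhds (s := Iio R))
      rwa [hφR, zero_rpow hp.ne'] at this
    refine tendsto_nhds_unique (h1.congr' ?_) h2
    filter_upwards [Ioo_mem_nhdsLT hRpos] with r hr
    exact (heq r hr.1 (hin r hr.1.le hr.2)).symm
  have hΘR : ∀ x : E3, ‖x‖ = R → pot (fun y => φ ‖y‖) x + k = 0 := fun x hx => by
    rw [hpotT x (norm_pos_iff.1 (hx ▸ hRpos)), hx, hTR]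
  have hΘout : ∀ x : E3, R < ‖x‖ → pot (fun y => φ ‖y‖) x + k < 0 := fun x hx => by
    rw [hpotT x (norm_pos_iff.1 (hRpos.trans hx)), ← hTR]
    exact hTstrict hRpos (hRpos.trans hx) hx
  refine ⟨R, φ, hρ, ha, hRpos, hφ, fun x => rfl, fun x => ?_, fun x hx => ?_, hΘR, hΘout⟩
  · rcases lt_trichotomy ‖x‖ R with h | h | h
    · exact eos_eq_of_rpow_eq hγ₁ (hφ0 _) (heq3 x (hin _ (norm_nonneg _) h))
    · rw [eos_of_nonpos ha (hΘR x h).le, h, hφR]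
    · rw [eos_of_nonpos ha (hΘout x h).le, hout _ h]
  · have := hin _ (norm_nonneg x) hx
    change 0 < pot (fun y => φ ‖y‖) x + k
    rw [← heq3 x this]
    positivity

end RotatingStar

namespace RotatingStar
open Metric Set Filter Topology
open scoped RealInnerProductSpace

lemma exists_norm_eq {r : ℝ} (hr : 0 ≤ r) : ∃ x : E3, ‖x‖ = r :=
  ⟨EuclideanSpace.single 2 r, by simp [abs_of_nonneg hr]⟩

lemma continuous_massFn {φ : ℝ → ℝ} (hφ : Continuous φ) : Continuous (massFn φ) :=
  continuous_iff_continuousAt.2 fun r => (hasDerivAt_massFn hφ r).continuousAt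

lemma abs_massFn_le {φ : ℝ → ℝ} {M : ℝ} (hM : ∀ r, 0 ≤ r → |φ r| ≤ M) {r : ℝ} (hr : 0 ≤ r) :
    |massFn φ r| ≤ 4 * π * M * r ^ 3 := by
  have h := intervalIntegral.norm_integral_le_of_norm_le_const (f := fun s => φ s * s ^ 2)
    (a := 0) (b := r) (C := M * r ^ 2) fun s hs => by
      rw [uIoc_of_le hr] at hs
      rw [norm_mul, Real.norm_eq_abs, norm_pow, Real.norm_eq_abs, abs_of_pos hs.1]
      have := hs.1
      have := hs.2
      have := (abs_nonneg _).trans (hM s hs.1.le)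
      gcongr
      exact hM s hs.1.le
  rw [sub_zero, abs_of_nonneg hr, Real.norm_eq_abs] at h
  have := pi_pos
  rw [massFn, abs_mul, abs_of_pos (by positivity : 0 < 4 * π)]
  calc 4 * π * |∫ s in 0..r, φ s * s ^ 2| ≤ 4 * π * (M * r ^ 2 * r) := by gcongr
    _ = 4 * π * M * r ^ 3 := by ring

namespace IsStar

variable {a R k : ℝ} {φ : ℝ → ℝ} {Θ : E3 → ℝ} (h : IsStar a R k φ Θ)

include h

lemma profile_pos {r : ℝ} (h0 : 0 ≤ r) (hr : r < R) : 0 < φ r := by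
  obtain ⟨x, rfl⟩ := exists_norm_eq h0
  rw [← h.eos_eq, eos_pos_iff h.one_lt]
  exact h.pos x hr

lemma profile_zero {r : ℝ} (hr : R ≤ r) : φ r = 0 := by
  obtain ⟨x, rfl⟩ := exists_norm_eq (h.radius_pos.le.trans hr)
  rw [← h.eos_eq]
  rcases hr.eq_or_lt with hr | hr
  · exact eos_of_nonpos h.one_lt (h.zero x hr.symm).le
  · exact eos_of_nonpos h.one_lt (h.neg x hr).le

lemma profile_nonneg {r : ℝ} (h0 : 0 ≤ r) : 0 ≤ φ r := by
  rcases lt_or_ge r R with hr | hr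
  · exact (h.profile_pos h0 hr).le
  · exact (h.profile_zero hr).ge

lemma exists_isDensity : ∃ M, IsDensity R M (fun y => φ ‖y‖) :=
  radial_isDensity h.cont fun _ hr => h.profile_zero hr.le

lemma mass_pos {r : ℝ} (hr : 0 < r) : 0 < massFn φ r := by
  have h0 := h.radius_pos
  have hφ := h.cont
  have : 0 < ∫ s in 0..r, φ s * s ^ 2 := by
    refine intervalIntegral.integral_pos hr (by fun_prop)
      (fun s hs => mul_nonneg (h.profile_nonneg hs.1.le) (sq_nonneg s))
      ⟨min r (R / 2), ⟨?_, min_le_left _ _⟩, ?_⟩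
    · positivity
    · have h1 : 0 < min r (R / 2) := by positivity
      have := h.profile_pos h1.le ((min_le_right _ _).trans_lt (by linarith))
      positivity
  unfold massFn
  positivity

lemma enthalpy_eq {x : E3} (hx : x ≠ 0) : Θ x = radialPot φ R ‖x‖ + k := by
  rw [h.pot_eq, pot_eq_radialPot h.cont (fun r hr => h.profile_zero hr.le) hx]

lemma continuous_enthalpy : Continuous Θ := by
  obtain ⟨M, hM⟩ := h.exists_isDensity
  rw [funext h.pot_eq]
  exact hM.continuous_pot.add continuous_const

lemma enthalpy_eq_of_norm_eq {x y : E3} (hxy : ‖x‖ = ‖y‖) : Θ x = Θ y := by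
  rw [h.pot_eq, h.pot_eq, pot_radial_eq_of_norm_eq φ hxy]

lemma weight_zero {x : E3} (hx : R ≤ ‖x‖) : eosDeriv a (Θ x) = 0 :=
  eosDeriv_of_nonpos h.one_lt (hx.eq_or_lt.elim (fun hx => (h.zero x hx.symm).le)
    fun hx => (h.neg x hx).le)

lemma weight_pos {x : E3} (hx : ‖x‖ < R) : 0 < eosDeriv a (Θ x) :=
  eosDeriv_pos h.one_lt (h.pos x hx)

lemma continuous_weight : Continuous fun x => eosDeriv a (Θ x) :=
  (continuous_eosDeriv h.one_lt).comp h.continuous_enthalpy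

lemma exists_isDensity_weight_mul {f : E3 → ℝ} (hf : Measurable f) {B : ℝ}
    (hB : ∀ x, ‖x‖ ≤ R → |f x| ≤ B) : ∃ M, IsDensity R M (fun x => eosDeriv a (Θ x) * f x) := by
  obtain ⟨M, hM⟩ := IsDensity.of_continuous h.continuous_weight
    (fun y hy => h.weight_zero (le_of_lt hy))
  refine ⟨M * B, hM.meas.mul hf.aestronglyMeasurable, fun y => ?_, fun y hy => ?_⟩
  · rcases le_or_gt ‖y‖ R with hy | hy
    · rw [abs_mul]
      exact mul_le_mul (hM.bound y) (hB y hy) (abs_nonneg _) hM.nonneg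
    · rw [h.weight_zero hy.le, zero_mul, abs_zero]
      have h0 := (abs_nonneg _).trans (hB 0 (by simpa using h.radius_pos.le))
      exact mul_nonneg hM.nonneg h0
  · simp [h.weight_zero hy.le]

lemma exists_isDensity_weight_mul_continuous {f : E3 → ℝ} (hf : Continuous f) :
    ∃ M, IsDensity R M (fun x => eosDeriv a (Θ x) * f x) :=
  IsDensity.of_continuous (h.continuous_weight.mul hf) fun y hy => by
    simp [h.weight_zero (le_of_lt hy)]

lemma exists_density_lipschitz : ∃ L, 0 ≤ L ∧ ∀ x y : E3, |φ ‖x‖ - φ ‖y‖| ≤ L * ‖x - y‖ := by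
  obtain ⟨M, hM⟩ := h.exists_isDensity
  obtain ⟨C, hC0, hC⟩ := exists_pot_lipschitz R
  obtain ⟨D, hD0, hD⟩ := exists_pot_bound R
  have hb : ∀ x, Θ x ∈ Icc (-(D * M + |k|)) (D * M + |k|) := fun x => abs_le.1 (by
    rw [h.pot_eq]
    exact (abs_add_le _ _).trans (add_le_add (hD M _ hM x) le_rfl))
  obtain ⟨K, hK⟩ := (isCompact_Icc (a := -(D * M + |k|)) (b := D * M + |k|)
    ).exists_bound_of_continuousOn (continuous_eosDeriv h.one_lt).continuousOn
  have hK0 : 0 ≤ K := (norm_nonneg _).trans (hK _ (hb 0))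
  refine ⟨K * (C * M), mul_nonneg hK0 (mul_nonneg hC0 hM.nonneg), fun x y => ?_⟩
  have h1 := (convex_Icc (-(D * M + |k|)) (D * M + |k|)).norm_image_sub_le_of_norm_hasDerivWithin_le
    (fun t _ => (hasDerivAt_eos h.one_lt t).hasDerivWithinAt) hK (hb y) (hb x)
  rw [h.eos_eq, h.eos_eq, Real.norm_eq_abs, Real.norm_eq_abs] at h1
  refine h1.trans ?_
  rw [mul_assoc]
  gcongr
  rw [h.pot_eq, h.pot_eq, add_sub_add_right_eq_sub]
  exact hC M _ hM x y

omit h in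
/-- Minus the derivative of the enthalpy in direction `e`. -/
noncomputable def _root_.RotatingStar.slope (φ : ℝ → ℝ) (e x : E3) : ℝ :=
  ⟪e, x⟫ * (massFn φ ‖x‖ / ‖x‖ ^ 3)

lemma hasDerivAt_enthalpy (e : E3) {x : E3} (hx : x ≠ 0) :
    HasDerivAt (fun t : ℝ => Θ (x + t • e)) (-slope φ e x) 0 := by
  have hl : HasDerivAt (fun t : ℝ => x + t • e) e 0 := by
    simpa using ((hasDerivAt_id (0 : ℝ)).smul_const e).const_add x
  have hn : HasDerivAt (fun t : ℝ => ‖x + t • e‖) (⟪e, x⟫ / ‖x‖) 0 := by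
    have h1 := hl.norm_sq
    have h2 := h1.sqrt (by simpa using hx)
    simp only [zero_smul, add_zero, Real.sqrt_sq (norm_nonneg _)] at h2
    refine h2.congr_deriv ?_
    rw [real_inner_comm]
    field_simp
  have hr : HasDerivAt (fun r => radialPot φ R r + k) (-massFn φ ‖x‖ / ‖x‖ ^ 2)
      ‖x + (0 : ℝ) • e‖ := by
    have := (hasDerivAt_radialPot h.cont R (norm_ne_zero_iff.2 hx)).add_const k
    simpa using this
  have hc := hr.comp 0 hn
  have hne : ∀ᶠ t : ℝ in 𝓝 0, x + t • e ≠ 0 :=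
    hl.continuousAt.eventually_ne (by simpa using hx)
  refine (hc.congr_of_eventuallyEq ?_).congr_deriv ?_
  · filter_upwards [hne] with t ht
    exact h.enthalpy_eq ht
  · have : ‖x‖ ≠ 0 := norm_ne_zero_iff.2 hx
    rw [slope]
    field_simp

lemma measurable_slope (e : E3) : Measurable (slope φ e) := by
  have := (continuous_massFn h.cont).measurable
  unfold slope
  fun_prop

lemma exists_slope_bound (e : E3) : ∃ B, ∀ x, ‖x‖ ≤ R → |slope φ e x| ≤ B := by
  obtain ⟨M, hM⟩ := h.exists_isDensity
  have hM' : ∀ r, 0 ≤ r → |φ r| ≤ M := fun r hr => by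
    obtain ⟨x, rfl⟩ := exists_norm_eq hr
    exact hM.bound x
  have hpi := pi_pos
  have hM0 := hM.nonneg
  refine ⟨‖e‖ * R * (4 * π * M), fun x hx => ?_⟩
  rw [slope, abs_mul]
  have h1 : |⟪e, x⟫| ≤ ‖e‖ * R := (abs_real_inner_le_norm e x).trans (by gcongr)
  refine mul_le_mul h1 ?_ (abs_nonneg _) (mul_nonneg (norm_nonneg _) h.radius_pos.le)
  rcases eq_or_ne x 0 with rfl | hx0
  · simp; positivity
  · have : 0 < ‖x‖ := norm_pos_iff.2 hx0
    rw [abs_div, abs_of_pos (by positivity : 0 < ‖x‖ ^ 3), div_le_iff₀ (by positivity)]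
    exact abs_massFn_le hM' (norm_nonneg _)

/-- The slope of the enthalpy is reproduced by the linearized potential operator
(translation invariance of the equation). -/
lemma slope_eq_pot (e : E3) {x : E3} (hx : x ≠ 0) :
    slope φ e x = pot (fun y => eosDeriv a (Θ y) * slope φ e y) x := by
  obtain ⟨M, hM⟩ := h.exists_isDensity
  obtain ⟨L, hL0, hL⟩ := h.exists_density_lipschitz
  have hφ := h.cont
  have h1 : HasDerivAt (fun t : ℝ => pot (fun y => φ ‖y‖) (x + t • e)) (-slope φ e x) 0 := by
    refine ((h.hasDerivAt_enthalpy e hx).sub_const k).congr_of_eventuallyEq ?_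
    filter_upwards with t
    rw [h.pot_eq]
    ring
  have htrans : ∀ (f : E3 → ℝ) (z : E3), pot f z = ∫ y, f (z - y) / ‖y‖ := fun f z => by
    rw [pot, ← integral_sub_left_eq_self _ volume z]
    simp
  set B := ‖x‖ + ‖e‖ + R with hB
  have hker : IntegrableOn (fun y : E3 => ‖y‖⁻¹) (closedBall 0 B) := by
    obtain ⟨C, -, hC⟩ := exists_kernel_bound (p := 1) (by norm_num) B
    simpa using (hC 0).1
  have h2 : HasDerivAt (fun t : ℝ => ∫ y, φ ‖x + t • e - y‖ / ‖y‖)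
      (∫ y, eosDeriv a (Θ (x - y)) * -slope φ e (x - y) / ‖y‖) 0 := by
    refine (hasDerivAt_integral_of_dominated_loc_of_lip (s := ball 0 1)
      (bound := (closedBall (0 : E3) B).indicator fun y => L * ‖e‖ * ‖y‖⁻¹)
      (ball_mem_nhds _ one_pos) ?_ ?_ ?_ ?_ ?_ ?_).2
    · filter_upwards with t
      exact (by fun_prop : Measurable fun y : E3 => φ ‖x + t • e - y‖ / ‖y‖).aestronglyMeasurable
    · have := (hM.integrable_div x).comp_sub_left x
      simpa using this
    · have h3 := h.measurable_slope e
      have h4 := h.continuous_weight.measurable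
      exact (((h4.comp (measurable_const.sub measurable_id)).mul
        (h3.comp (measurable_const.sub measurable_id)).neg).div
          measurable_norm).aestronglyMeasurable
    · filter_upwards with y
      refine LipschitzOnWith.of_dist_le_mul fun t ht s hs => ?_
      rw [Real.dist_eq, Real.dist_eq, Real.coe_nnabs]
      by_cases hy : y ∈ closedBall (0 : E3) B
      · rw [indicator_of_mem hy, abs_of_nonneg (by positivity : 0 ≤ L * ‖e‖ * ‖y‖⁻¹), ← sub_div, abs_div, abs_norm,
          div_eq_mul_inv]
        refine (mul_le_mul_of_nonneg_right (hL _ _) (by positivity)).trans (le_of_eq ?_)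
        have : x + t • e - y - (x + s • e - y) = (t - s) • e := by module
        rw [this, norm_smul, Real.norm_eq_abs]
        ring
      · have hz : ∀ t ∈ ball (0 : ℝ) 1, φ ‖x + t • e - y‖ = 0 := fun t ht => by
          refine h.profile_zero ?_
          have h5 : B < ‖y‖ := by simpa using hy
          have h6 : ‖y‖ ≤ ‖x‖ + ‖t • e‖ + ‖x + t • e - y‖ := by
            have : y = x + t • e - (x + t • e - y) := by module
            calc ‖y‖ = ‖x + t • e - (x + t • e - y)‖ := by rw [← this]
              _ ≤ ‖x + t • e‖ + ‖x + t • e - y‖ := norm_sub_le _ _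
              _ ≤ _ := by gcongr; exact norm_add_le _ _
          have h7 : ‖t • e‖ ≤ ‖e‖ := by
            rw [norm_smul]
            have : ‖t‖ ≤ 1 := by simpa using (mem_ball_zero_iff.1 ht).le
            exact mul_le_of_le_one_left (norm_nonneg _) this
          linarith
        rw [indicator_of_notMem hy, hz t ht, hz s hs]
        simp
    · exact (integrable_indicator_iff measurableSet_closedBall).2 (hker.const_mul _)
    · filter_upwards [compl_mem_ae_iff.2 (measure_singleton x)] with y hy
      have hxy : x - y ≠ 0 := sub_ne_zero.2 (Ne.symm hy)
      have h3 := h.hasDerivAt_enthalpy e hxy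
      have h4 : HasDerivAt (eos a) (eosDeriv a (Θ (x - y))) (Θ (x - y + (0 : ℝ) • e)) := by
        simpa using hasDerivAt_eos h.one_lt (Θ (x - y))
      refine ((h4.comp 0 h3).div_const ‖y‖).congr_of_eventuallyEq ?_
      filter_upwards with t
      simp only [Function.comp_apply, h.eos_eq]
      congr 3
      module
  have h3 : (fun t : ℝ => pot (fun y => φ ‖y‖) (x + t • e)) =
      fun t : ℝ => ∫ y, φ ‖x + t • e - y‖ / ‖y‖ := by
    ext t
    rw [htrans]
  rw [h3] at h1
  have h4 := h1.unique h2
  rw [htrans, ← neg_eq_iff_eq_neg.2 h4.symm, ← integral_neg]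
  congr 1 with y
  ring

end IsStar

end RotatingStar

namespace RotatingStar
open Metric Set Filter Topology
open scoped RealInnerProductSpace

section Reflection

variable (e : E3)

/-- The reflection in the plane orthogonal to `e`. -/
noncomputable abbrev refl : E3 ≃ₗᵢ[ℝ] E3 := (ℝ ∙ e)ᗮ.reflection

lemma refl_refl (x : E3) : refl e (refl e x) = x := Submodule.reflection_reflection _ x

lemma refl_self : refl e e = -e := Submodule.reflection_orthogonalComplement_singleton_eq_neg e

lemma inner_refl (x : E3) : ⟪e, refl e x⟫ = -⟪e, x⟫ := by
  rw [← (refl e).inner_map_map, refl_refl, refl_self, inner_neg_left]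

lemma refl_apply (x : E3) : refl e x = x - (2 * (⟪e, x⟫ / ‖e‖ ^ 2)) • e := by
  rw [refl, Submodule.reflection_orthogonal_apply, Submodule.reflection_singleton_apply]
  simp only [RCLike.ofReal_real_eq_id, id_eq]
  module

lemma norm_refl_sub_sq (x y : E3) :
    ‖refl e x - y‖ ^ 2 = ‖x - y‖ ^ 2 + 4 * ⟪e, x⟫ * ⟪e, y⟫ / ‖e‖ ^ 2 := by
  rw [norm_sub_sq_real, norm_sub_sq_real, (refl e).norm_map, refl_apply, inner_sub_left,
    real_inner_smul_left]
  ring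

/-- The difference of the Newtonian kernels at a point and at its mirror image. -/
noncomputable def mirrorKernel (x y : E3) : ℝ := ‖x - y‖⁻¹ - ‖refl e x - y‖⁻¹

variable {e}

lemma mirrorKernel_nonneg {x y : E3} (hxy : y ≠ x) (hx : 0 ≤ ⟪e, x⟫) (hy : 0 ≤ ⟪e, y⟫) :
    0 ≤ mirrorKernel e x y := by
  have h1 : 0 < ‖x - y‖ := norm_pos_iff.2 (sub_ne_zero.2 hxy.symm)
  refine sub_nonneg.2 (inv_anti₀ h1 (le_of_sq_le_sq ?_ (norm_nonneg _)))
  rw [norm_refl_sub_sq]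
  have : 0 ≤ 4 * ⟪e, x⟫ * ⟪e, y⟫ / ‖e‖ ^ 2 := by positivity
  linarith

lemma mirrorKernel_refl_right (x y : E3) : mirrorKernel e x (refl e y) = -mirrorKernel e x y := by
  have h1 : ‖x - refl e y‖ = ‖refl e x - y‖ := by
    rw [← (refl e).norm_map, map_sub, refl_refl]
  have h2 : ‖refl e x - refl e y‖ = ‖x - y‖ := by
    rw [← map_sub, (refl e).norm_map]
  rw [mirrorKernel, h1, h2, mirrorKernel]
  ring

lemma mirrorKernel_ne_zero {x y : E3} (he : e ≠ 0) (hx : ⟪e, x⟫ ≠ 0) (hy : ⟪e, y⟫ ≠ 0) :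
    mirrorKernel e x y ≠ 0 := by
  intro h
  have h1 : ‖x - y‖ = ‖refl e x - y‖ := inv_injective (sub_eq_zero.1 h)
  have h2 := norm_refl_sub_sq e x y
  rw [← h1] at h2
  have : 4 * ⟪e, x⟫ * ⟪e, y⟫ / ‖e‖ ^ 2 ≠ 0 := by
    have := norm_ne_zero_iff.2 he
    positivity
  exact this (by linarith)

variable {S M M' : ℝ} {f F : E3 → ℝ}

lemma pot_refl_of_odd (hodd : ∀ y, f (refl e y) = -f y) (x : E3) :
    pot f (refl e x) = -pot f x := by
  rw [← pot_comp_isometry]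
  simp only [hodd]
  simpa using pot_const_mul (-1) f x

lemma integrable_mul_mirrorKernel (hf : IsDensity S M f) (x : E3) :
    Integrable fun y => f y * mirrorKernel e x y := by
  refine ((hf.integrable_div x).sub (hf.integrable_div (refl e x))).congr ?_
  filter_upwards with y
  simp only [Pi.sub_apply, mirrorKernel]
  ring

lemma integral_mul_mirrorKernel (hf : IsDensity S M f) (hodd : ∀ y, f (refl e y) = -f y) (x : E3) :
    ∫ y, f y * mirrorKernel e x y = 2 * pot f x := by
  have h1 : pot f x - pot f (refl e x) = ∫ y, f y * mirrorKernel e x y := by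
    rw [pot, pot, ← integral_sub (hf.integrable_div x) (hf.integrable_div (refl e x))]
    congr 1 with y
    simp only [mirrorKernel]
    ring
  rw [← h1, pot_refl_of_odd hodd]
  ring

lemma abs_mul_mirrorKernel_le (hodd : ∀ y, f (refl e y) = -f y) (hFodd : ∀ y, F (refl e y) = -F y)
    (hle : ∀ y, 0 ≤ ⟪e, y⟫ → |f y| ≤ F y) {x y : E3} (hx : 0 ≤ ⟪e, x⟫) (hxy : y ≠ x)
    (hxy' : y ≠ refl e x) : |f y * mirrorKernel e x y| ≤ F y * mirrorKernel e x y := by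
  have key : ∀ z, z ≠ x → 0 ≤ ⟪e, z⟫ → |f z * mirrorKernel e x z| ≤ F z * mirrorKernel e x z := by
    intro z hz h0
    have h1 := mirrorKernel_nonneg hz hx h0
    rw [abs_mul, abs_of_nonneg h1]
    exact mul_le_mul_of_nonneg_right (hle z h0) h1
  rcases le_or_gt 0 ⟪e, y⟫ with h0 | h0
  · exact key y hxy h0
  · have h1 := key (refl e y) (fun h => hxy' (by rw [← h, refl_refl]))
      (by rw [inner_refl]; linarith)
    rw [hodd, hFodd, mirrorKernel_refl_right, neg_mul_neg, neg_mul_neg] at h1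
    exact h1

lemma ae_ne_and_ne (x x' : E3) : ∀ᵐ y : E3, y ≠ x ∧ y ≠ x' := by
  filter_upwards [compl_mem_ae_iff.2 (measure_singleton x),
    compl_mem_ae_iff.2 (measure_singleton x')] with y h1 h2 using ⟨h1, h2⟩

/-- Odd rearrangement increases the potential on the half space. -/
lemma abs_pot_le_pot (hf : IsDensity S M f) (hF : IsDensity S M' F)
    (hodd : ∀ y, f (refl e y) = -f y) (hFodd : ∀ y, F (refl e y) = -F y)
    (hle : ∀ y, 0 ≤ ⟪e, y⟫ → |f y| ≤ F y) {x : E3} (hx : 0 ≤ ⟪e, x⟫) :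
    |pot f x| ≤ pot F x := by
  have h1 : |∫ y, f y * mirrorKernel e x y| ≤ ∫ y, F y * mirrorKernel e x y := by
    refine abs_integral_le_integral_abs.trans (integral_mono_ae
      (integrable_mul_mirrorKernel hf x).abs (integrable_mul_mirrorKernel hF x) ?_)
    filter_upwards [ae_ne_and_ne x (refl e x)] with y hy
    exact abs_mul_mirrorKernel_le hodd hFodd hle hx hy.1 hy.2
  rw [integral_mul_mirrorKernel hf hodd, integral_mul_mirrorKernel hF hFodd, abs_mul,
    abs_of_pos two_pos] at h1
  linarith

/-- If the potential of an odd density which is nonnegative on the half space vanishes at a point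
of the open half space, then the density vanishes. -/
lemma ae_eq_zero_of_pot_eq_zero (he : e ≠ 0) (hF : IsDensity S M F)
    (hFodd : ∀ y, F (refl e y) = -F y) (hnn : ∀ y, 0 ≤ ⟪e, y⟫ → 0 ≤ F y)
    (hF0 : ∀ y, ⟪e, y⟫ = 0 → F y = 0) {x : E3} (hx : 0 < ⟪e, x⟫) (h0 : pot F x = 0) :
    ∀ᵐ y, F y = 0 := by
  have h1 := integral_mul_mirrorKernel hF hFodd x
  rw [h0, mul_zero, integral_eq_zero_iff_of_nonneg_ae _ (integrable_mul_mirrorKernel hF x)] at h1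
  · filter_upwards [h1] with y hy
    by_cases hy0 : ⟪e, y⟫ = 0
    · exact hF0 y hy0
    · exact (mul_eq_zero.1 hy).resolve_right (mirrorKernel_ne_zero he hx.ne' hy0)
  · filter_upwards [ae_ne_and_ne x (refl e x)] with y hy
    refine (abs_nonneg (0 * mirrorKernel e x y)).trans ?_
    refine abs_mul_mirrorKernel_le (f := fun _ => 0) (by simp) hFodd ?_ hx.le hy.1 hy.2
    intro y hy
    simpa using hnn y hy

end Reflection

namespace IsStar

variable {a R k : ℝ} {φ : ℝ → ℝ} {Θ : E3 → ℝ} (h : IsStar a R k φ Θ)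

include h

lemma slope_nonneg {e x : E3} (hx : 0 ≤ ⟪e, x⟫) : 0 ≤ slope φ e x := by
  refine mul_nonneg hx (div_nonneg ?_ (by positivity))
  rcases (norm_nonneg x).eq_or_lt with h0 | h0
  · simp [← h0, massFn]
  · exact (h.mass_pos h0).le

lemma slope_pos {e x : E3} (hx : 0 < ⟪e, x⟫) : 0 < slope φ e x := by
  have : 0 < ‖x‖ := norm_pos_iff.2 fun h0 => by simp [h0] at hx
  have := h.mass_pos this
  unfold slope
  positivity

omit h in
lemma _root_.RotatingStar.slope_refl (e x : E3) : slope φ e (refl e x) = -slope φ e x := by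
  rw [slope, inner_refl, (refl e).norm_map, slope]
  ring

/-- An even solution of the linearized equation that is odd under a reflection vanishes. -/
lemma eq_zero_of_odd {e : E3} (he : e ≠ 0) {g : E3 → ℝ} (hg : Continuous g)
    (hpot : ∀ x, g x = pot (fun y => eosDeriv a (Θ y) * g y) x)
    (hodd : ∀ x, g (refl e x) = -g x) (heven : ∀ x, g (-x) = g x) (x : E3) : g x = 0 := by
  set V : E3 → ℝ := fun y => eosDeriv a (Θ y) with hV
  have hV0 : ∀ y, 0 ≤ V y := fun y => eosDeriv_nonneg h.one_lt _
  have hVrefl : ∀ y, V (refl e y) = V y := fun y => by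
    simp only [hV]
    rw [h.enthalpy_eq_of_norm_eq ((refl e).norm_map y)]
  have hg0 : ∀ y, ⟪e, y⟫ = 0 → g y = 0 := fun y hy => by
    have := hodd y
    rw [refl_apply, hy] at this
    simp only [zero_div, mul_zero, zero_smul, sub_zero] at this
    linarith
  set G : E3 → ℝ := fun y => if 0 ≤ ⟪e, y⟫ then |g y| else -|g y| with hG
  have hGpos : ∀ y, 0 ≤ ⟪e, y⟫ → G y = |g y| := fun y hy => if_pos hy
  have hGodd : ∀ y, G (refl e y) = -G y := fun y => by
    simp only [hG, inner_refl, hodd, abs_neg]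
    rcases lt_trichotomy ⟪e, y⟫ 0 with h1 | h1 | h1
    · rw [if_pos (by linarith), if_neg (by linarith)]; ring
    · rw [hg0 y h1]; simp
    · rw [if_neg (by linarith), if_pos (by linarith)]
  have hGmeas : Measurable G := by
    refine Measurable.ite (measurableSet_le measurable_const ?_) hg.measurable.abs
      hg.measurable.abs.neg
    exact (by fun_prop : Continuous fun y : E3 => ⟪e, y⟫).measurable
  have hGabs : ∀ y, |G y| = |g y| := fun y => by
    simp only [hG]
    split_ifs <;> simp
  obtain ⟨Mg, hMg⟩ := h.exists_isDensity_weight_mul_continuous hg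
  obtain ⟨B, hB⟩ := (isCompact_closedBall (0 : E3) R).exists_bound_of_continuousOn hg.continuousOn
  obtain ⟨MG, hMG⟩ := h.exists_isDensity_weight_mul hGmeas (B := B) fun y hy => by
    rw [hGabs]
    exact hB y (by simpa using hy)
  obtain ⟨Bψ, hBψ⟩ := h.exists_slope_bound e
  obtain ⟨Mψ, hMψ⟩ := h.exists_isDensity_weight_mul (h.measurable_slope e) hBψ
  have hVgodd : ∀ y, V (refl e y) * g (refl e y) = -(V y * g y) := fun y => by
    rw [hVrefl, hodd]; ring
  have hVGodd : ∀ y, V (refl e y) * G (refl e y) = -(V y * G y) := fun y => by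
    rw [hVrefl, hGodd]; ring
  have hle : ∀ y, 0 ≤ ⟪e, y⟫ → |V y * g y| ≤ V y * G y := fun y hy => by
    rw [abs_mul, abs_of_nonneg (hV0 y), hGpos y hy]
  set P : E3 → ℝ := pot (fun y => V y * G y) with hP
  have hPodd : ∀ y, P (refl e y) = -P y := fun y => pot_refl_of_odd hVGodd y
  have hgP : ∀ y, 0 ≤ ⟪e, y⟫ → |g y| ≤ P y := fun y hy => by
    rw [hpot y]
    exact abs_pot_le_pot hMg hMG hVgodd hVGodd hle hy
  have hPc : Continuous P := hMG.continuous_pot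
  have hint1 : Integrable fun y => V y * slope φ e y * P y := by
    obtain ⟨C, hC⟩ := exists_pot_bound R
    exact (hMψ.mul_bounded hPc.aestronglyMeasurable (hC.2 MG _ hMG)).integrable
  have hint2 : Integrable fun y => V y * G y * slope φ e y := by
    obtain ⟨M, hM⟩ := h.exists_isDensity_weight_mul (hGmeas.mul (h.measurable_slope e))
      (B := B * Bψ) fun y hy => by
        have h1 := hB y (by simpa using hy)
        rw [Pi.mul_apply, abs_mul, hGabs]
        exact mul_le_mul h1 (hBψ y hy) (abs_nonneg _) ((norm_nonneg _).trans h1)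
    refine hM.integrable.congr ?_
    filter_upwards with y
    simp only [Pi.mul_apply, hV]
    ring
  have hsym : ∫ y, V y * slope φ e y * P y = ∫ y, V y * G y * slope φ e y := by
    rw [hMψ.integral_mul_pot_comm hMG]
    refine integral_congr_ae ?_
    filter_upwards [ae_ne_and_ne 0 0] with y hy
    rw [h.slope_eq_pot e hy.1]
  have hzero : ∫ y, (V y * slope φ e y * P y - V y * G y * slope φ e y) = 0 := by
    rw [integral_sub hint1 hint2, hsym, sub_self]
  have hnn : ∀ y, 0 ≤ V y * slope φ e y * P y - V y * G y * slope φ e y := by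
    have key : ∀ y, 0 ≤ ⟪e, y⟫ → 0 ≤ V y * slope φ e y * P y - V y * G y * slope φ e y := by
      intro y hy
      have : V y * slope φ e y * P y - V y * G y * slope φ e y =
        V y * slope φ e y * (P y - G y) := by ring
      rw [this, hGpos y hy]
      exact mul_nonneg (mul_nonneg (hV0 y) (h.slope_nonneg hy)) (sub_nonneg.2 (hgP y hy))
    intro y
    rcases le_or_gt 0 ⟪e, y⟫ with hy | hy
    · exact key y hy
    · have := key (refl e y) (by rw [inner_refl]; linarith)
      rw [hVrefl, slope_refl, hPodd, hGodd] at this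
      linarith
  rw [integral_eq_zero_iff_of_nonneg hnn (hint1.sub hint2)] at hzero
  set U : Set E3 := {y | 0 < ⟪e, y⟫} ∩ ball 0 R with hU
  have hUo : IsOpen U := (isOpen_lt continuous_const (by fun_prop)).inter isOpen_ball
  have hEq : EqOn P (fun y => |g y|) U := by
    refine Measure.eqOn_open_of_ae_eq (μ := volume) ?_ hUo hPc.continuousOn hg.abs.continuousOn
    rw [EventuallyEq, ae_restrict_iff' hUo.measurableSet]
    filter_upwards [hzero] with y hy hyU
    have h1 : V y * slope φ e y * (P y - G y) = 0 := by
      have : V y * slope φ e y * P y - V y * G y * slope φ e y = 0 := hy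
      linarith
    have h2 : 0 < V y * slope φ e y := mul_pos (h.weight_pos (by simpa using hyU.2))
      (h.slope_pos hyU.1)
    have h3 := (mul_eq_zero.1 h1).resolve_left h2.ne'
    rw [hGpos y (le_of_lt hyU.1)] at h3
    linarith
  have hR := h.radius_pos
  have hen : 0 < ‖e‖ := norm_pos_iff.2 he
  set x₀ : E3 := (R / (2 * ‖e‖)) • e with hx₀
  have hx₀e : 0 < ⟪e, x₀⟫ := by
    rw [hx₀, real_inner_smul_right, real_inner_self_eq_norm_sq]
    positivity
  have hx₀U : x₀ ∈ U := by
    refine ⟨hx₀e, ?_⟩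
    rw [mem_ball_zero_iff, hx₀, norm_smul, Real.norm_eq_abs, abs_of_pos (by positivity)]
    field_simp
    linarith
  have hgx₀ : g x₀ = 0 := by
    have h1 := hodd x₀
    rw [hx₀, map_smul, refl_self, smul_neg, heven, ← hx₀] at h1
    linarith
  have hPx₀ : P x₀ = 0 := by
    rw [hEq hx₀U]
    simp [hgx₀]
  have hae := ae_eq_zero_of_pot_eq_zero he hMG hVGodd
    (fun y hy => (abs_nonneg _).trans (hle y hy))
    (fun y hy => by rw [hGpos y hy.ge, hg0 y hy]; simp) hx₀e hPx₀
  rw [hpot x, pot]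
  refine integral_eq_zero_of_ae ?_
  filter_upwards [hae] with y hy
  have : |V y * g y| = 0 := by
    rw [abs_mul, ← hGabs, ← abs_mul, hy, abs_zero]
  rw [abs_eq_zero.1 this]
  simp

/-- Even solutions of the linearized equation are radial. -/
lemma radial_of_even {u : E3 → ℝ} (hu : Continuous u)
    (hpot : ∀ x, u x = pot (fun y => eosDeriv a (Θ y) * u y) x)
    (heven : ∀ x, u (-x) = u x) {x y : E3} (hxy : ‖x‖ = ‖y‖) : u x = u y := by
  rcases eq_or_ne x y with rfl | hne
  · rfl
  set e := x - y with he
  have hσ : refl e x = y := Submodule.reflection_sub hxy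
  obtain ⟨M, hM⟩ := h.exists_isDensity_weight_mul_continuous hu
  have h1 := h.eq_zero_of_odd (sub_ne_zero.2 hne) (g := fun z => u z - u (refl e z))
    (hu.sub (hu.comp (refl e).continuous)) (fun z => ?_) (fun z => by rw [refl_refl]; ring)
    (fun z => by rw [map_neg, heven, heven]) x
  · rw [hσ] at h1
    linarith
  · rw [hpot z, hpot (refl e z), ← pot_comp_isometry, ← hM.pot_sub (hM.comp_isometry (refl e))]
    congr 1 with y
    rw [h.enthalpy_eq_of_norm_eq ((refl e).norm_map y)]
    ring

end IsStar

end RotatingStar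

namespace RotatingStar
open Metric Set Filter Topology

namespace IsStar

variable {a R k : ℝ} {φ : ℝ → ℝ} {Θ : E3 → ℝ} (h : IsStar a R k φ Θ)

include h

/-- Radial solutions of the linearized equation vanish on the sphere of radius `R`: the Wronskian
with the solution generated by the scaling symmetry is constant. -/
lemma massFn_radius_eq_zero {W η U : ℝ → ℝ} (hη : Continuous η)
    (hW : ∀ r, 0 < r → W r = eosDeriv a (radialPot φ R r + k))
    (hU : U = radialPot η R) (hηU : ∀ r, 0 < r → η r = W r * U r)
    {l : ℝ} (hl : Tendsto U (𝓝[>] 0) (𝓝 l)) : massFn η R = 0 := by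
  set c := 2 / (a - 1) with hc
  have ha : 0 < a - 1 := by have := h.one_lt; linarith
  have hca : c * a = c + 2 := by rw [hc]; field_simp; ring
  have hR := h.radius_pos
  set T : ℝ → ℝ := fun r => radialPot φ R r + k with hT
  set m := massFn φ with hm
  set M := massFn η with hM
  have hφT : ∀ r, 0 < r → φ r = eos a (T r) := fun r hr => by
    obtain ⟨x, rfl⟩ := exists_norm_eq hr.le
    rw [← h.eos_eq, h.enthalpy_eq (norm_pos_iff.1 hr)]
  have hT' : ∀ r, 0 < r → HasDerivAt T (-m r / r ^ 2) r := fun r hr =>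
    (hasDerivAt_radialPot h.cont R hr.ne').add_const k
  have hm' : ∀ r, HasDerivAt m (4 * π * (φ r * r ^ 2)) r := hasDerivAt_massFn h.cont
  have hM' : ∀ r, HasDerivAt M (4 * π * (η r * r ^ 2)) r := hasDerivAt_massFn hη
  have hU' : ∀ r, 0 < r → HasDerivAt U (-M r / r ^ 2) r := fun r hr => by
    rw [hU]
    exact hasDerivAt_radialPot hη R hr.ne'
  have hφ' : ∀ r, 0 < r → HasDerivAt φ (W r * (-m r / r ^ 2)) r := fun r hr => by
    rw [hW r hr]
    refine ((hasDerivAt_eos h.one_lt (T r)).comp r (hT' r hr)).congr_of_eventuallyEq ?_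
    filter_upwards [Ioi_mem_nhds hr] with s hs using hφT s hs
  set z : ℝ → ℝ := fun r => (1 - c) * m r - 4 * π * (r ^ 3 * φ r) with hz
  set w : ℝ → ℝ := fun r => c * T r - m r / r with hw
  have hφW : ∀ r, 0 < r → W r * T r = a * φ r := fun r hr => by
    rw [hW r hr, hφT r hr]
    exact eosDeriv_mul_self h.one_lt _
  have hconst : ∀ r, 0 < r → HasDerivAt (fun r => z r * U r + M r * w r) 0 r := fun r hr => by
    have hz' := ((hm' r).const_mul (1 - c)).sub
      ((((hasDerivAt_id r).pow 3).mul (hφ' r hr)).const_mul (4 * π))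
    have hw' := ((hT' r hr).const_mul c).sub ((hm' r).div (hasDerivAt_id r) hr.ne')
    refine ((hz'.mul (hU' r hr)).add ((hM' r).mul hw')).congr_deriv ?_
    have e1 := hφW r hr
    have e2 := hηU r hr
    simp only [id_eq, Pi.pow_apply, Pi.sub_apply, Pi.mul_apply, Pi.div_apply, e2]
    have hr' := hr.ne'
    field_simp
    push_cast
    linear_combination (4 * π * U r * r ^ 4) * (c * e1 + φ r * hca)
  have hlim : Tendsto (fun r => z r * U r + M r * w r) (𝓝[>] 0) (𝓝 0) := by
    have hm0 : m 0 = 0 := by simp [hm, massFn]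
    have hM0 : M 0 = 0 := by simp [hM, massFn]
    have hφc := h.cont
    have hmc : Continuous m := continuous_massFn h.cont
    have hzl : Tendsto z (𝓝[>] 0) (𝓝 0) := by
      have : Continuous z := by fun_prop
      have := (this.tendsto 0).mono_left (nhdsWithin_le_nhds (s := Ioi 0))
      simpa [hz, hm0] using this
    have hMl : Tendsto M (𝓝[>] 0) (𝓝 0) := by
      have := ((continuous_massFn hη).tendsto 0).mono_left (nhdsWithin_le_nhds (s := Ioi 0))
      rwa [← hM, hM0] at this
    have hmr : Tendsto (fun r => m r / r) (𝓝[>] 0) (𝓝 0) := by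
      have := (hm' 0).tendsto_slope_zero_right
      simp only [zero_add, hm0, sub_zero, smul_eq_mul] at this
      simpa [div_eq_inv_mul] using this
    have hTl : Tendsto T (𝓝[>] 0) (𝓝 (Θ 0)) := by
      have h1 : Continuous fun r : ℝ => Θ (EuclideanSpace.single 2 r) :=
        h.continuous_enthalpy.comp (by
          refine (Isometry.of_dist_eq fun r s => ?_).continuous
          simp)
      have h2 := (h1.tendsto 0).mono_left (nhdsWithin_le_nhds (s := Ioi 0))
      rw [show (EuclideanSpace.single 2 (0 : ℝ) : E3) = 0 by simp] at h2
      refine h2.congr' ?_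
      filter_upwards [self_mem_nhdsWithin] with r hr
      have hr : 0 < r := hr
      have hn : ‖(EuclideanSpace.single 2 r : E3)‖ = r := by simp [abs_of_pos hr]
      rw [h.enthalpy_eq (norm_pos_iff.1 (by rw [hn]; exact hr)), hn]
    have := (hzl.mul hl).add (hMl.mul ((hTl.const_mul c).sub hmr))
    simpa using this
  have hWR : z R * U R + M R * w R = 0 := by
    refine tendsto_nhds_unique (tendsto_const_nhds.congr' ?_) hlim
    filter_upwards [self_mem_nhdsWithin] with r hr
    exact isOpen_Ioi.is_const_of_deriv_eq_zero isPreconnected_Ioi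
      (fun s hs => (hconst s hs).differentiableAt.differentiableWithinAt)
      (fun s hs => (hconst s hs).deriv) hR hr
  have hTR : T R = 0 := by
    obtain ⟨x, hx⟩ := exists_norm_eq hR.le
    have h1 := h.enthalpy_eq (norm_pos_iff.1 (hx ▸ hR))
    rw [h.zero x hx, hx] at h1
    exact h1.symm
  have hUR : U R = M R / R := by rw [hU, radialPot]; simp [hM]
  have hmR := h.mass_pos hR
  simp only [hz, hw, h.profile_zero le_rfl, hTR, hUR] at hWR
  have hcpos : 0 < c := by positivity
  have e3 : c * m R * M R = 0 := by
    field_simp at hWR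
    linear_combination -hWR
  exact (mul_eq_zero.1 e3).resolve_left (mul_pos hcpos hmR).ne'

/-- Radial solutions of the linearized equation vanish. -/
lemma eq_zero_of_radial {u : E3 → ℝ} (hu : Continuous u)
    (hpot : ∀ x, u x = pot (fun y => eosDeriv a (Θ y) * u y) x)
    (hrad : ∀ x y : E3, ‖x‖ = ‖y‖ → u x = u y) (x : E3) : u x = 0 := by
  set e : ℝ → E3 := fun r => EuclideanSpace.single 2 r with he
  have hec : Continuous e := by
    refine (Isometry.of_dist_eq fun r s => ?_).continuous
    simp [he]
  have hen : ∀ r, ‖e r‖ = |r| := fun r => by simp [he]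
  have hR := h.radius_pos
  set W : ℝ → ℝ := fun r => eosDeriv a (Θ (e r)) with hW
  set η : ℝ → ℝ := fun r => W r * u (e r) with hηdef
  have hWc : Continuous W := h.continuous_weight.comp hec
  have hη : Continuous η := hWc.mul (hu.comp hec)
  have hηx : ∀ x, eosDeriv a (Θ x) * u x = η ‖x‖ := fun x => by
    have : ‖x‖ = ‖e ‖x‖‖ := by rw [hen, abs_norm]
    simp only [hηdef, hW]
    rw [← h.enthalpy_eq_of_norm_eq this, ← hrad _ _ this]
  have hηR : ∀ r, R < r → η r = 0 := fun r hr => by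
    simp only [hηdef, hW]
    rw [h.weight_zero, zero_mul]
    rw [hen]
    exact hr.le.trans (le_abs_self r)
  set U := radialPot η R with hU
  set M := massFn η with hM
  have huU : ∀ x, x ≠ 0 → u x = U ‖x‖ := fun x hx => by
    rw [hpot, funext hηx, pot_eq_radialPot hη hηR hx]
  have hueU : ∀ r, 0 < r → u (e r) = U r := fun r hr => by
    have : ‖e r‖ = r := by rw [hen, abs_of_pos hr]
    rw [huU _ (norm_pos_iff.1 (by rwa [this])), this]
  have hηU : ∀ r, 0 < r → η r = W r * U r := fun r hr => by rw [← hueU r hr]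
  have hl : Tendsto U (𝓝[>] 0) (𝓝 (u (e 0))) := by
    refine (((hu.comp hec).tendsto 0).mono_left nhdsWithin_le_nhds).congr' ?_
    filter_upwards [self_mem_nhdsWithin] with r hr using hueU r hr
  have hMR : M R = 0 := by
    refine h.massFn_radius_eq_zero hη (fun r hr => ?_) hU hηU hl
    have : ‖e r‖ = r := by rw [hen, abs_of_pos hr]
    simp only [hW]
    rw [h.enthalpy_eq (norm_pos_iff.1 (by rwa [this])), this]
  have hUR : U R = 0 := by
    rw [hU, radialPot, ← hM, hMR]
    simp
  have hU0 : ∀ r, 0 < r → r ≤ R → U r = 0 := by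
    intro ε hε hεR
    obtain ⟨B, hB⟩ := (isCompact_Icc (a := ε) (b := R)).exists_bound_of_continuousOn
      hWc.continuousOn
    have hB0 : 0 ≤ B := (norm_nonneg _).trans (hB R ⟨hεR, le_rfl⟩)
    have hpi := pi_pos
    set K : ℝ := 1 / ε ^ 2 + 4 * π * (R ^ 2 * B) with hK
    have hK0 : 0 ≤ K := by positivity
    have hode := ODE_solution_unique_of_mem_Icc_left (E := ℝ × ℝ) (a := ε) (b := R)
      (v := fun t p => (-p.2 / t ^ 2, 4 * π * (W t * p.1 * t ^ 2))) (s := fun _ => univ)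
      (K := K.toNNReal) (f := fun t => (U t, M t)) (g := fun _ => 0) ?_ ?_ ?_
      (fun _ _ => mem_univ _) continuousOn_const ?_ (fun _ _ => mem_univ _) ?_
    · exact congrArg Prod.fst (hode ⟨le_rfl, hεR⟩)
    · intro t ht
      have ht0 : 0 < t := hε.trans ht.1
      refine (LipschitzWith.of_dist_le_mul fun p q => ?_).lipschitzOnWith
      rw [Real.coe_toNNReal _ hK0, Prod.dist_eq, Prod.dist_eq, Real.dist_eq, Real.dist_eq]
      simp only
      set D := max (dist p.1 q.1) (dist p.2 q.2) with hD
      have hD1 : |p.1 - q.1| ≤ D := le_max_left _ _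
      have hD2 : |p.2 - q.2| ≤ D := le_max_right _ _
      have hD0 : 0 ≤ D := (abs_nonneg _).trans hD1
      refine max_le ?_ ?_
      · have e1 : -p.2 / t ^ 2 - -q.2 / t ^ 2 = -((p.2 - q.2) * (1 / t ^ 2)) := by ring
        rw [e1, abs_neg, abs_mul, abs_of_pos (by positivity : 0 < 1 / t ^ 2)]
        calc |p.2 - q.2| * (1 / t ^ 2) ≤ D * (1 / ε ^ 2) := by
              gcongr
              exact ht.1.le
          _ ≤ K * D := by
              rw [mul_comm]
              refine mul_le_mul_of_nonneg_right ?_ hD0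
              rw [hK]
              exact le_add_of_nonneg_right (by positivity)
      · have e1 : 4 * π * (W t * p.1 * t ^ 2) - 4 * π * (W t * q.1 * t ^ 2) =
            4 * π * (t ^ 2 * W t) * (p.1 - q.1) := by ring
        rw [e1, abs_mul, abs_mul (4 * π), abs_mul (t ^ 2), abs_of_pos (by positivity : 0 < 4 * π),
          abs_of_pos (by positivity : 0 < t ^ 2)]
        calc 4 * π * (t ^ 2 * |W t|) * |p.1 - q.1| ≤ 4 * π * (R ^ 2 * B) * D := by
              gcongr
              · exact ht.2
              · exact hB t ⟨ht.1.le, ht.2⟩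
          _ ≤ K * D := by
              refine mul_le_mul_of_nonneg_right ?_ hD0
              rw [hK]
              exact le_add_of_nonneg_left (by positivity)
    · refine ContinuousOn.prodMk (fun t ht => ?_) (continuous_massFn hη).continuousOn
      exact (hasDerivAt_radialPot hη R (hε.trans_le ht.1).ne').continuousAt.continuousWithinAt
    · intro t ht
      have ht0 : 0 < t := hε.trans ht.1
      refine HasDerivAt.hasDerivWithinAt ?_
      refine ((hasDerivAt_radialPot hη R ht0.ne').prodMk (hasDerivAt_massFn hη t)).congr_deriv ?_
      rw [hηU t ht0]
    · intro t _
      refine ((hasDerivAt_const t (0 : ℝ × ℝ)).congr_deriv ?_).hasDerivWithinAt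
      simp only [Prod.fst_zero, Prod.snd_zero, neg_zero, zero_div, mul_zero, zero_mul]
      rfl
    · simp only [hUR, hMR]
      rfl
  have hη0 : ∀ r, 0 < r → η r = 0 := fun r hr => by
    rcases le_or_gt r R with h1 | h1
    · rw [hηU r hr, hU0 r hr h1, mul_zero]
    · exact hηR r h1
  rw [hpot, funext hηx, pot]
  refine integral_eq_zero_of_ae ?_
  filter_upwards [ae_ne_and_ne 0 0] with y hy
  rw [hη0 _ (norm_pos_iff.2 hy.1)]
  simp

/-- The linearized operator has trivial kernel on even functions. -/
lemma eq_zero_of_even {u : E3 → ℝ} (hu : Continuous u)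
    (hpot : ∀ x, u x = pot (fun y => eosDeriv a (Θ y) * u y) x)
    (heven : ∀ x, u (-x) = u x) (x : E3) : u x = 0 :=
  h.eq_zero_of_radial hu hpot (fun _ _ hxy => h.radial_of_even hu hpot heven hxy) x

end IsStar

end RotatingStar

namespace RotatingStar
open Metric Set Filter Topology

section Even

variable {S : ℝ}

/-- The antipodal map of a centred ball. -/
noncomputable def antipode (S : ℝ) : C(closedBall (0 : E3) S, closedBall (0 : E3) S) where
  toFun x := ⟨-x, by rw [mem_closedBall_zero_iff, norm_neg]; exact mem_closedBall_zero_iff.1 x.2⟩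
  continuous_toFun := by fun_prop

lemma antipode_antipode (x : closedBall (0 : E3) S) : antipode S (antipode S x) = x :=
  Subtype.ext (neg_neg _)

lemma coe_antipode (x : closedBall (0 : E3) S) : (antipode S x : E3) = -x := rfl

/-- The projection onto even functions. -/
noncomputable def evenPart (S : ℝ) : C(closedBall (0 : E3) S, ℝ) →L[ℝ] C(closedBall (0 : E3) S, ℝ) :=
  (2⁻¹ : ℝ) • (ContinuousLinearMap.id ℝ _ +
    { toLinearMap := (ContinuousMap.compRightAlgHom ℝ ℝ (antipode S)).toLinearMap
      cont := ContinuousMap.compRightAlgHom_continuous ℝ ℝ (antipode S) })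

lemma evenPart_apply (f : C(closedBall (0 : E3) S, ℝ)) (x : closedBall (0 : E3) S) :
    evenPart S f x = 2⁻¹ * (f x + f (antipode S x)) := rfl

lemma evenPart_antipode (f : C(closedBall (0 : E3) S, ℝ)) (x : closedBall (0 : E3) S) :
    evenPart S f (antipode S x) = evenPart S f x := by
  rw [evenPart_apply, evenPart_apply, antipode_antipode, add_comm]

lemma evenPart_of_even {f : C(closedBall (0 : E3) S, ℝ)} (hf : ∀ x, f (antipode S x) = f x) :
    evenPart S f = f := by
  ext x
  rw [evenPart_apply, hf]
  ring

lemma zeroExt_neg {f : closedBall (0 : E3) S → ℝ} (hf : ∀ x, f (antipode S x) = f x) (y : E3) :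
    zeroExt S f (-y) = zeroExt S f y := by
  by_cases hy : y ∈ closedBall (0 : E3) S
  · rw [zeroExt_of_mem _ hy, zeroExt_of_mem _ (by simpa using hy)]
    exact hf ⟨y, hy⟩
  · have hy : S < ‖y‖ := by simpa using hy
    rw [zeroExt_of_lt _ hy, zeroExt_of_lt _ (by simpa using hy)]

lemma pot_neg {f : E3 → ℝ} (hf : ∀ y, f (-y) = f y) (x : E3) : pot f (-x) = pot f x := by
  have := pot_comp_isometry f (LinearIsometryEquiv.neg ℝ) x
  simp only [LinearIsometryEquiv.coe_neg, hf] at this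
  exact this.symm

lemma potOp_antipode {f : C(closedBall (0 : E3) S, ℝ)} (hf : ∀ x, f (antipode S x) = f x)
    (x : closedBall (0 : E3) S) : potOp S f (antipode S x) = potOp S f x :=
  pot_neg (zeroExt_neg hf) x

end Even

namespace IsStar

variable {a R k : ℝ} {φ : ℝ → ℝ} {Θ : E3 → ℝ} (h : IsStar a R k φ Θ)

/-- The enthalpy restricted to a ball. -/
noncomputable def enthalpyOn (S : ℝ) : C(closedBall (0 : E3) S, ℝ) :=
  ⟨fun x => Θ x, h.continuous_enthalpy.comp continuous_subtype_val⟩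

lemma zeroExt_eos_enthalpyOn {S : ℝ} (hS : R ≤ S) :
    zeroExt S (fun x => eos a (h.enthalpyOn S x)) = fun y => φ ‖y‖ := by
  ext y
  by_cases hy : y ∈ closedBall (0 : E3) S
  · rw [zeroExt_of_mem _ hy]
    exact h.eos_eq y
  · have hy : S < ‖y‖ := by simpa using hy
    rw [zeroExt_of_lt _ hy, h.profile_zero (hS.trans hy.le)]

lemma enthalpyOn_antipode {S : ℝ} (x : closedBall (0 : E3) S) :
    h.enthalpyOn S (antipode S x) = h.enthalpyOn S x :=
  h.enthalpy_eq_of_norm_eq (norm_neg _)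

include h in
/-- The linearized operator, restricted to even functions, has trivial kernel. -/
lemma eq_zero_of_linearized {S : ℝ} (hS : R ≤ S) {V : C(closedBall (0 : E3) S, ℝ)}
    (hV : ∀ x, V x = eosDeriv a (Θ x)) {f : C(closedBall (0 : E3) S, ℝ)}
    (hf : potOp S (mulOp V (evenPart S f)) = f) : f = 0 := by
  set q := mulOp V (evenPart S f) with hq
  have hqe : ∀ x, q (antipode S x) = q x := fun x => by
    rw [hq, mulOp_apply, mulOp_apply, evenPart_antipode, hV, hV, coe_antipode,
      h.enthalpy_eq_of_norm_eq (norm_neg _)]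
  have hfe : ∀ x, f (antipode S x) = f x := fun x => by
    rw [← hf, potOp_antipode hqe]
  set u : E3 → ℝ := pot (zeroExt S q) with hu
  have huf : ∀ x : closedBall (0 : E3) S, u x = f x := fun x => by
    rw [← hf]
    rfl
  have hqV : zeroExt S q = fun y => eosDeriv a (Θ y) * u y := by
    ext y
    by_cases hy : y ∈ closedBall (0 : E3) S
    · rw [zeroExt_of_mem _ hy, hq, mulOp_apply, evenPart_of_even hfe, hV, ← huf]
    · have hy : S < ‖y‖ := by simpa using hy
      rw [zeroExt_of_lt _ hy, h.weight_zero (hS.trans hy.le), zero_mul]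
  have hu0 := h.eq_zero_of_even (u := u) (zeroExt_isDensity q).continuous_pot
    (fun x => by rw [← hqV]) (fun x => pot_neg (zeroExt_neg hqe) x)
  ext x
  rw [← huf, hu0]
  rfl

/-- Continuation of a nonrotating star to solutions of the equation with a small even
perturbation of the potential. -/
lemma exists_branch {S : ℝ} (hS : R ≤ S) {J : C(closedBall (0 : E3) S, ℝ)}
    (hJ : ∀ x, J (antipode S x) = J x) :
    ∃ r, 0 < r ∧ ∃ u : ℝ → C(closedBall (0 : E3) S, ℝ), u 0 = h.enthalpyOn S ∧
      ∀ κ, |κ| < r → ContinuousAt u κ ∧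
        ∀ x, u κ x = pot (zeroExt S fun y => eos a (u κ y)) x + k + κ ^ 2 * J x := by
  set F : C(ℝ, ℝ) := ⟨eos a, continuous_eos h.one_lt⟩ with hF
  set F' : C(ℝ, ℝ) := ⟨eosDeriv a, continuous_eosDeriv h.one_lt⟩ with hF'
  set θ := h.enthalpyOn S with hθ
  have hθe : evenPart S θ = θ := evenPart_of_even h.enthalpyOn_antipode
  set V : C(closedBall (0 : E3) S, ℝ) := F'.comp θ with hV
  set K := potOp S ∘L mulOp V ∘L evenPart S with hK
  have hKc : IsCompactOperator K := (isCompactOperator_potOp S).comp_clm (mulOp V ∘L evenPart S)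
  obtain ⟨A, hA⟩ := exists_equiv_of_compact K hKc fun f hf =>
    h.eq_zero_of_linearized hS (fun x => rfl) hf
  set G : C(closedBall (0 : E3) S, ℝ) → C(closedBall (0 : E3) S, ℝ) :=
    fun u => u - potOp S (F.comp (evenPart S u)) with hG
  have hGd : HasStrictFDerivAt G (A : C(closedBall (0 : E3) S, ℝ) →L[ℝ] _) θ := by
    rw [hA]
    refine (hasStrictFDerivAt_id θ).sub ?_
    refine (potOp S).hasStrictFDerivAt.comp θ (HasStrictFDerivAt.comp θ
      (g := fun w : C(closedBall (0 : E3) S, ℝ) => F.comp w) (g' := mulOp V) ?_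
      (evenPart S).hasStrictFDerivAt)
    rw [hθe]
    exact hasStrictFDerivAt_superposition F F' (fun t => hasDerivAt_eos h.one_lt t) θ
  set Φ := hGd.toOpenPartialHomeomorph G with hΦ
  have hΦG : ∀ u, Φ u = G u := fun u => rfl
  set y : ℝ → C(closedBall (0 : E3) S, ℝ) :=
    fun κ => ContinuousMap.const _ k + κ ^ 2 • J with hy
  have hyc : Continuous y := by fun_prop
  have hy0 : y 0 = G θ := by
    ext x
    have h1 : potOp S (F.comp (evenPart S θ)) x = pot (fun y => φ ‖y‖) x := by
      rw [hθe, ← h.zeroExt_eos_enthalpyOn hS]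
      rfl
    change k + (0 : ℝ) ^ 2 * J x = Θ x - potOp S (F.comp (evenPart S θ)) x
    rw [h1, h.pot_eq]
    ring
  have hmem : y ⁻¹' Φ.target ∈ 𝓝 0 := hyc.continuousAt.preimage_mem_nhds
    (Φ.open_target.mem_nhds (hy0 ▸ hGd.image_mem_toOpenPartialHomeomorph_target))
  obtain ⟨r, hr, hball⟩ := Metric.mem_nhds_iff.1 hmem
  have htarget : ∀ κ, |κ| < r → y κ ∈ Φ.target := fun κ hκ => hball (by simpa using hκ)
  refine ⟨r, hr, fun κ => Φ.symm (y κ), ?_, fun κ hκ => ⟨?_, ?_⟩⟩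
  · simp only [hy0, ← hΦG]
    exact Φ.left_inv hGd.mem_toOpenPartialHomeomorph_source
  · exact (Φ.continuousAt_symm (htarget κ hκ)).comp hyc.continuousAt
  · set u := Φ.symm (y κ) with hu
    have hGu : G u = y κ := Φ.right_inv (htarget κ hκ)
    have heq : ∀ x, u x = potOp S (F.comp (evenPart S u)) x + k + κ ^ 2 * J x := fun x => by
      have h1 : u x - potOp S (F.comp (evenPart S u)) x = k + κ ^ 2 * J x :=
        congrArg (fun f => f x) hGu
      linarith
    have hue : evenPart S u = u := evenPart_of_even fun x => by
      rw [heq, heq x, hJ, potOp_antipode]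
      intro x
      simp only [ContinuousMap.comp_apply, evenPart_antipode]
    intro x
    have h2 := heq x
    rw [hue] at h2
    exact h2

end IsStar

/-- The radial retraction onto a centred ball. -/
noncomputable def ballRetraction {S : ℝ} (hS : 0 < S) (y : E3) : closedBall (0 : E3) S :=
  ⟨(S / max S ‖y‖) • y, by
    have h1 : 0 < max S ‖y‖ := hS.trans_le (le_max_left _ _)
    rw [mem_closedBall_zero_iff, norm_smul, Real.norm_eq_abs, abs_of_pos (by positivity),
      div_mul_eq_mul_div, div_le_iff₀ h1]
    exact mul_le_mul_of_nonneg_left (le_max_right _ _) hS.le⟩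

lemma continuous_ballRetraction {S : ℝ} (hS : 0 < S) : Continuous (ballRetraction hS) := by
  have h1 : Continuous fun y : E3 => (S / max S ‖y‖) • y :=
    (continuous_const.div (continuous_const.max continuous_norm) fun y =>
      (hS.trans_le (le_max_left _ _)).ne').smul continuous_id
  exact h1.subtype_mk _

/-- The zero extension of a function vanishing on the boundary of the ball is continuous. -/
lemma continuous_zeroExt {S : ℝ} (hS : 0 < S) {f : C(closedBall (0 : E3) S, ℝ)}
    (hf : ∀ x : closedBall (0 : E3) S, ‖(x : E3)‖ = S → f x = 0) : Continuous (zeroExt S f) := by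
  have : zeroExt S f = f ∘ ballRetraction hS := by
    ext y
    rcases le_or_gt ‖y‖ S with hy | hy
    · rw [zeroExt_of_mem _ (by simpa using hy)]
      refine congrArg f (Subtype.ext ?_)
      simp [ballRetraction, max_eq_left hy, hS.ne']
    · rw [zeroExt_of_lt _ hy]
      refine (hf _ ?_).symm
      have hy0 : 0 < ‖y‖ := hS.trans hy
      simp only [ballRetraction]
      rw [max_eq_right hy.le, norm_smul, Real.norm_eq_abs, abs_of_pos (by positivity)]
      field_simp
  rw [this]
  exact f.continuous.comp (continuous_ballRetraction hS)

/-- The centrifugal potential is continuous. -/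
lemma continuous_integral_cylRad {f : ℝ → ℝ} (hf : ContinuousOn f (Ici 0)) :
    Continuous fun x => ∫ s in (0 : ℝ)..cylRad x, f s := by
  have hc : Continuous fun s : ℝ => f (max 0 s) :=
    hf.comp_continuous (by fun_prop) fun s => mem_Ici.2 (le_max_left _ _)
  have h1 : ∀ x, ∫ s in (0 : ℝ)..cylRad x, f s = ∫ s in (0 : ℝ)..cylRad x, f (max 0 s) := fun x => by
    refine intervalIntegral.integral_congr fun s hs => ?_
    rw [uIcc_of_le (show (0 : ℝ) ≤ cylRad x from Real.sqrt_nonneg _)] at hs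
    simp only [max_eq_right hs.1]
  simp only [h1]
  have hr : Continuous cylRad := by
    unfold cylRad
    fun_prop
  exact (intervalIntegral.continuous_primitive (fun a b => hc.intervalIntegrable a b) 0).comp hr

end RotatingStar

open RotatingStar Metric

/-- Lichtenstein's theorem: for `6/5 < γ < 2`, any Lane–Emden solution `ρ₀` can be
continued to a continuous-in-`κ` family of compactly supported rotating star solutions
with rotation profile `κ ω₀(r)`, for all sufficiently small `κ`. -/
theorem lichtenstein_slowly_rotating_stars
    (γ : ℝ) (hγ₁ : 6/5 < γ) (hγ₂ : γ < 2)
    (ρ₀ : EuclideanSpace ℝ (Fin 3) → ℝ)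
    (hρ₀cont : Continuous ρ₀) (hρ₀nonneg : ∀ x, 0 ≤ ρ₀ x)
    (hρ₀supp : HasCompactSupport ρ₀)
    (hρ₀radial : ∀ x y : EuclideanSpace ℝ (Fin 3), ‖x‖ = ‖y‖ → ρ₀ x = ρ₀ y)
    (hρ₀LaneEmden : ∃ k : ℝ, ∀ x : EuclideanSpace ℝ (Fin 3),
      0 < ρ₀ x → ρ₀ x ^ (γ - 1) - pot ρ₀ x = k)
    (ω₀ : ℝ → ℝ) (hω₀ : ContDiffOn ℝ (⊤ : ℕ∞) ω₀ (Set.Ici 0)) :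
    ∃ κmax : ℝ, 0 < κmax ∧
      ∃ ρ : ℝ → (EuclideanSpace ℝ (Fin 3) → ℝ),
        ρ 0 = ρ₀ ∧
        (∀ κ : ℝ, |κ| < κmax →
          Continuous (ρ κ) ∧ (∀ x, 0 ≤ ρ κ x) ∧ HasCompactSupport (ρ κ) ∧
          ∃ k : ℝ, ∀ x : EuclideanSpace ℝ (Fin 3), 0 < ρ κ x →
            (ρ κ x) ^ (γ - 1) - pot (ρ κ) x
              - ∫ s in (0:ℝ)..(cylRad x), κ^2 * (ω₀ s)^2 * s = k) ∧
        -- continuity of `κ ↦ ρ κ` into `C(ℝ³)` with the supremum norm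
        (∀ κ : ℝ, |κ| < κmax → ∀ ε : ℝ, 0 < ε → ∃ δ : ℝ, 0 < δ ∧
          ∀ κ' : ℝ, |κ'| < κmax → |κ' - κ| < δ →
            ∀ x : EuclideanSpace ℝ (Fin 3), |ρ κ' x - ρ κ x| ≤ ε) := by
  by_cases hne : ∃ x, ρ₀ x ≠ 0
  swap
  · push Not at hne
    refine ⟨1, one_pos, fun _ _ => 0, (funext hne).symm, fun κ _ => ⟨continuous_const,
      fun _ => le_rfl, HasCompactSupport.zero, 0, fun x hx => absurd hx (lt_irrefl _)⟩,
      fun κ _ ε hε => ⟨1, one_pos, fun _ _ _ _ => by simpa using hε.le⟩⟩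
  obtain ⟨k, hk⟩ := hρ₀LaneEmden
  have hγ : 1 < γ := by linarith
  obtain ⟨R, φ, hρφ, h⟩ := exists_isStar hγ hγ₂ hρ₀cont hρ₀nonneg hρ₀supp hρ₀radial hk hne
  set Θ : E3 → ℝ := fun x => pot (fun y => φ ‖y‖) x + k
  set a := 1 / (γ - 1) with ha
  have hR := h.radius_pos
  set S := R + 1 with hSdef
  have hS : 0 < S := by linarith
  have hω : ContinuousOn (fun s => (ω₀ s) ^ 2 * s) (Set.Ici 0) :=
    (hω₀.continuousOn.pow 2).mul continuousOn_id
  set J : C(closedBall (0 : E3) S, ℝ) :=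
    ⟨fun x => ∫ s in (0:ℝ)..(cylRad x), (ω₀ s) ^ 2 * s,
      (continuous_integral_cylRad hω).comp continuous_subtype_val⟩ with hJ
  have hJe : ∀ x, J (antipode S x) = J x := fun x => by
    simp [hJ, coe_antipode, cylRad]
  obtain ⟨r, hr, u, hu0, hu⟩ := h.exists_branch (by linarith : R ≤ S) hJe
  -- a neighbourhood of the parameter `0` for which the enthalpy stays negative on the sphere
  obtain ⟨d, hd, hdneg⟩ : ∃ d > 0, ∀ x : E3, ‖x‖ = S → Θ x < -d := by
    obtain ⟨x₀, hx₀, hmax⟩ := (isCompact_sphere (0 : E3) S).exists_isMaxOn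
      ((NormedSpace.sphere_nonempty).2 hS.le) h.continuous_enthalpy.continuousOn
    have h1 : Θ x₀ < 0 := h.neg x₀ (by rw [mem_sphere_zero_iff_norm.1 hx₀]; linarith)
    refine ⟨-Θ x₀ / 2, by linarith, fun x hx => ?_⟩
    have h2 : Θ x ≤ Θ x₀ := hmax (mem_sphere_zero_iff_norm.2 hx)
    linarith
  obtain ⟨r', hr', hclose⟩ := Metric.continuousAt_iff.1 (hu 0 (by simpa using hr)).1 d hd
  have hbdry : ∀ κ, |κ| < r' → ∀ x : closedBall (0 : E3) S, ‖(x : E3)‖ = S → u κ x < 0 := by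
    intro κ hκ x hx
    have h1 : dist (u κ) (u 0) < d := hclose (by simpa using hκ)
    have h2 := (ContinuousMap.dist_apply_le_dist x).trans_lt h1
    rw [hu0, Real.dist_eq, abs_lt] at h2
    have h3 := hdneg x hx
    have h4 : h.enthalpyOn S x = Θ x := rfl
    linarith [h2.2]
  set F : C(ℝ, ℝ) := ⟨eos a, continuous_eos h.one_lt⟩ with hF
  set ρ : ℝ → E3 → ℝ := fun κ => zeroExt S (F.comp (u κ)) with hρ
  refine ⟨min r r', lt_min hr hr', ρ, ?_, fun κ hκ => ?_, fun κ hκ ε hε => ?_⟩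
  · rw [hρφ, ← h.zeroExt_eos_enthalpyOn (by linarith : R ≤ S), ← hu0]
    rfl
  · have hκr := hκ.trans_le (min_le_left _ _)
    refine ⟨continuous_zeroExt hS fun x hx => ?_, fun x => ?_, ?_, k, fun x hx => ?_⟩
    · exact eos_of_nonpos h.one_lt (hbdry κ (hκ.trans_le (min_le_right _ _)) x hx).le
    · by_cases hx : x ∈ closedBall (0 : E3) S
      · simp only [hρ]
        rw [zeroExt_of_mem _ hx]
        exact eos_nonneg _
      · exact (zeroExt_of_lt _ (by simpa using hx)).ge
    · exact HasCompactSupport.intro (isCompact_closedBall (0 : E3) S) fun x hx =>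
        zeroExt_of_lt _ (by simpa using hx)
    · have hxS : x ∈ closedBall (0 : E3) S := by
        by_contra hxS
        exact hx.ne' (zeroExt_of_lt _ (by simpa using hxS))
      have hρx : ρ κ x = eos a (u κ ⟨x, hxS⟩) := zeroExt_of_mem _ hxS
      rw [hρx] at hx ⊢
      have h1 := (hu κ hκr).2 ⟨x, hxS⟩
      rw [ha, eos_rpow hγ ((eos_pos_iff h.one_lt).1 hx).le]
      have h2 : ∫ s in (0:ℝ)..(cylRad x), κ ^ 2 * (ω₀ s) ^ 2 * s = κ ^ 2 * J ⟨x, hxS⟩ := by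
        simp only [mul_assoc]
        exact intervalIntegral.integral_const_mul _ _
      have h3 : pot (ρ κ) x = pot (zeroExt S fun y => eos a (u κ y)) x := rfl
      rw [h2, h3]
      linarith
  · have hc : ContinuousAt (fun κ => F.comp (u κ)) κ :=
      F.continuous_postcomp.continuousAt.comp (hu κ (hκ.trans_le (min_le_left _ _))).1
    obtain ⟨δ, hδ, hδ'⟩ := Metric.continuousAt_iff.1 hc ε hε
    refine ⟨δ, hδ, fun κ' _ hκ' x => ?_⟩
    have h1 : dist (F.comp (u κ')) (F.comp (u κ)) < ε := hδ' (by rwa [Real.dist_eq])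
    simp only [hρ]
    by_cases hx : x ∈ closedBall (0 : E3) S
    · rw [zeroExt_of_mem _ hx, zeroExt_of_mem _ hx, ← Real.dist_eq]
      exact (ContinuousMap.dist_apply_le_dist _).trans h1.le
    · have hx : S < ‖x‖ := by simpa using hx
      rw [zeroExt_of_lt _ hx, zeroExt_of_lt _ hx]
      simpa using hε.le
end
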